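/- Let X be a smooth projective variety over an algebraically closed field, φ: X → X a separable morphism, and L an ample line bundle on X with φ*(L) ≅ L^{⊗d} for some d > 1. If the Kodaira dimension of X is ≥ 0, i.e. H^0(X, ω_X^{⊗n}) ≠ 0 for some n > 0, then φ is étale. -/

import Mathlib

open AlgebraicGeometry CategoryTheory CategoryTheory.Limits Opposite

noncomputable section

universe u

/-- Restriction of sections of the structure sheaf, as a ring homomorphism. -/
def sres (X : Scheme.{u}) {V W : X.Opens} (h : V ≤ W) : Γ(X, W) →+* Γ(X, V) :=
  (X.presheaf.map (homOfLE h).op : Γ(X, W) ⟶ Γ(X, V)).hom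

lemma sres_sres (X : Scheme.{u}) {V W T : X.Opens} (h₁ : V ≤ W) (h₂ : W ≤ T) (a : Γ(X, T)) :
    sres X h₁ (sres X h₂ a) = sres X (h₁.trans h₂) a := by
  have : (homOfLE (h₁.trans h₂)).op = (homOfLE h₂).op ≫ (homOfLE h₁).op := rfl
  simp only [sres, this, Functor.map_comp]
  rfl

/-- A line bundle (invertible sheaf) on a scheme `X`, presented by an open cover and a
Čech `1`-cocycle of transition units. -/
structure LineBundle (X : Scheme.{u}) where
  ι : Type u
  U : ι → X.Opens
  covers : iSup U = ⊤
  t : ∀ i j, (Γ(X, U i ⊓ U j))ˣ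
  cocycle : ∀ i j l,
    Units.map (sres X (show U i ⊓ U j ⊓ U l ≤ U i ⊓ U j from inf_le_left)).toMonoidHom (t i j)
      * Units.map (sres X (show U i ⊓ U j ⊓ U l ≤ U j ⊓ U l from
          le_inf (inf_le_left.trans inf_le_right) inf_le_right)).toMonoidHom (t j l)
    = Units.map (sres X (show U i ⊓ U j ⊓ U l ≤ U i ⊓ U l from
          le_inf (inf_le_left.trans inf_le_left) inf_le_right)).toMonoidHom (t i l)

namespace LineBundle

variable {X Y : Scheme.{u}}

/-- The `n`-th tensor power of a line bundle. -/
def pow (L : LineBundle X) (n : ℕ) : LineBundle X where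
  ι := L.ι
  U := L.U
  covers := L.covers
  t i j := L.t i j ^ n
  cocycle i j l := by
    simp only [map_pow, ← mul_pow, L.cocycle i j l]

/-- The dual (inverse) of a line bundle. -/
def dual (L : LineBundle X) : LineBundle X where
  ι := L.ι
  U := L.U
  covers := L.covers
  t i j := (L.t i j)⁻¹
  cocycle i j l := by
    simp only [map_inv, ← mul_inv, L.cocycle i j l]

/-- The trivial line bundle. -/
def trivial (X : Scheme.{u}) : LineBundle X where
  ι := PUnit
  U _ := ⊤
  covers := by simp
  t _ _ := 1
  cocycle _ _ _ := by simp

lemma unit_sres_sres (X : Scheme.{u}) {V W T : X.Opens} (h₁ : V ≤ W) (h₂ : W ≤ T)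
    (u : (Γ(X, T))ˣ) :
    Units.map (sres X h₁).toMonoidHom (Units.map (sres X h₂).toMonoidHom u)
      = Units.map (sres X (h₁.trans h₂)).toMonoidHom u := by
  ext
  exact sres_sres X h₁ h₂ u

/-- The tensor product of two line bundles. -/
def tensor (L M : LineBundle X) : LineBundle X where
  ι := L.ι × M.ι
  U p := L.U p.1 ⊓ M.U p.2
  covers := by
    apply le_antisymm le_top
    have h : (⊤ : X.Opens) = (⨆ i, L.U i) ⊓ ⨆ j, M.U j := by
      rw [L.covers, M.covers, top_inf_eq]
    rw [h, iSup_inf_eq]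
    refine iSup_le fun i => ?_
    rw [inf_iSup_eq]
    exact iSup_le fun j => le_iSup_of_le (i, j) le_rfl
  t p q :=
    Units.map (sres X (show (L.U p.1 ⊓ M.U p.2) ⊓ (L.U q.1 ⊓ M.U q.2) ≤ L.U p.1 ⊓ L.U q.1 from
        le_inf (inf_le_left.trans inf_le_left) (inf_le_right.trans inf_le_left))).toMonoidHom
      (L.t p.1 q.1) *
    Units.map (sres X (show (L.U p.1 ⊓ M.U p.2) ⊓ (L.U q.1 ⊓ M.U q.2) ≤ M.U p.2 ⊓ M.U q.2 from
        le_inf (inf_le_left.trans inf_le_right) (inf_le_right.trans inf_le_right))).toMonoidHom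
      (M.t p.2 q.2)
  cocycle p q r := by
    simp only [map_mul, unit_sres_sres]
    have hL := congrArg (Units.map (sres X (show
        (L.U p.1 ⊓ M.U p.2) ⊓ (L.U q.1 ⊓ M.U q.2) ⊓ (L.U r.1 ⊓ M.U r.2) ≤
          L.U p.1 ⊓ L.U q.1 ⊓ L.U r.1 from
        le_inf (le_inf (inf_le_left.trans (inf_le_left.trans inf_le_left))
          (inf_le_left.trans (inf_le_right.trans inf_le_left)))
          (inf_le_right.trans inf_le_left))).toMonoidHom) (L.cocycle p.1 q.1 r.1)
    have hM := congrArg (Units.map (sres X (show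
        (L.U p.1 ⊓ M.U p.2) ⊓ (L.U q.1 ⊓ M.U q.2) ⊓ (L.U r.1 ⊓ M.U r.2) ≤
          M.U p.2 ⊓ M.U q.2 ⊓ M.U r.2 from
        le_inf (le_inf (inf_le_left.trans (inf_le_left.trans inf_le_right))
          (inf_le_left.trans (inf_le_right.trans inf_le_right)))
          (inf_le_right.trans inf_le_right))).toMonoidHom) (M.cocycle p.2 q.2 r.2)
    simp only [map_mul, unit_sres_sres] at hL hM
    rw [mul_mul_mul_comm, hL, hM]

lemma preimage_mono (f : X ⟶ Y) {U U' : Y.Opens} (h : U ≤ U') : f ⁻¹ᵁ U ≤ f ⁻¹ᵁ U' :=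
  fun _ hx => h hx

lemma unit_sres_appLE (f : X ⟶ Y) {U : Y.Opens} {V V' : X.Opens} (e : V ≤ f ⁻¹ᵁ U)
    (h : V' ≤ V) (u : (Γ(Y, U))ˣ) :
    Units.map (sres X h).toMonoidHom (Units.map (f.appLE U V e).hom.toMonoidHom u)
      = Units.map (f.appLE U V' (h.trans e)).hom.toMonoidHom u := by
  ext
  show sres X h (f.appLE U V e u) = f.appLE U V' (h.trans e) u
  rw [show f.appLE U V' (h.trans e)
      = f.appLE U V e ≫ X.presheaf.map (homOfLE h).op from (f.appLE_map e (homOfLE h).op).symm]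
  rfl

lemma unit_appLE_sres (f : X ⟶ Y) {U U' : Y.Opens} {V : X.Opens} (e : V ≤ f ⁻¹ᵁ U)
    (h : U ≤ U') (u : (Γ(Y, U'))ˣ) :
    Units.map (f.appLE U V e).hom.toMonoidHom (Units.map (sres Y h).toMonoidHom u)
      = Units.map (f.appLE U' V (e.trans (preimage_mono f h))).hom.toMonoidHom u := by
  ext
  show f.appLE U V e (sres Y h u) = f.appLE U' V _ u
  rw [show f.appLE U' V (e.trans (preimage_mono f h))
      = Y.presheaf.map (homOfLE h).op ≫ f.appLE U V e from (f.map_appLE e (homOfLE h).op).symm]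
  rfl

lemma preimage_inf (f : X ⟶ Y) (U V : Y.Opens) :
    f ⁻¹ᵁ (U ⊓ V) = f ⁻¹ᵁ U ⊓ f ⁻¹ᵁ V := by
  ext x; simp

set_option maxHeartbeats 1000000 in
/-- The pullback of a line bundle along a morphism of schemes. -/
def pullbackLB (f : X ⟶ Y) (L : LineBundle Y) : LineBundle X where
  ι := L.ι
  U i := f ⁻¹ᵁ L.U i
  covers := by
    have : (⨆ i, f ⁻¹ᵁ L.U i) = f ⁻¹ᵁ (⨆ i, L.U i) := by
      ext x
      simp [TopologicalSpace.Opens.mem_iSup]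
    rw [this, L.covers]
    rfl
  t i j :=
    Units.map (f.appLE (L.U i ⊓ L.U j) (f ⁻¹ᵁ L.U i ⊓ f ⁻¹ᵁ L.U j)
      (preimage_inf f (L.U i) (L.U j)).ge).hom.toMonoidHom (L.t i j)
  cocycle i j l := by
    have key := congrArg (Units.map (f.appLE (L.U i ⊓ L.U j ⊓ L.U l)
        (f ⁻¹ᵁ L.U i ⊓ f ⁻¹ᵁ L.U j ⊓ f ⁻¹ᵁ L.U l)
        (le_of_eq (show f ⁻¹ᵁ L.U i ⊓ f ⁻¹ᵁ L.U j ⊓ f ⁻¹ᵁ L.U l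
            = f ⁻¹ᵁ (L.U i ⊓ L.U j ⊓ L.U l) by
          rw [preimage_inf, preimage_inf]))).hom.toMonoidHom)
      (L.cocycle i j l)
    rw [map_mul] at key
    rw [unit_sres_appLE, unit_sres_appLE, unit_sres_appLE]
    rw [unit_appLE_sres, unit_appLE_sres, unit_appLE_sres] at key
    exact key

/-- A global section of a line bundle: compatible local sections with respect to the
transition cocycle. -/
@[ext]
structure GlobalSec {X : Scheme.{u}} (L : LineBundle X) where
  s : ∀ i, Γ(X, L.U i)
  compat : ∀ i j, sres X (inf_le_left : L.U i ⊓ L.U j ≤ L.U i) (s i)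
    = (L.t i j : Γ(X, L.U i ⊓ L.U j)) * sres X inf_le_right (s j)

/-- The open locus where a global section of a line bundle does not vanish. -/
def GlobalSec.locus {X : Scheme.{u}} {L : LineBundle X} (σ : GlobalSec L) : X.Opens :=
  ⨆ i, X.basicOpen (σ.s i)

/-- A line bundle `L` on a scheme `X` is ample if `X` is quasi-compact and every point has
an affine neighbourhood of the form `X_s` for a global section `s` of some positive tensor
power of `L`. -/
def IsAmple {X : Scheme.{u}} (L : LineBundle X) : Prop :=
  CompactSpace X ∧ ∀ x : X, ∃ (m : ℕ) (_ : 0 < m) (σ : GlobalSec (L.pow m)),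
    x ∈ σ.locus ∧ IsAffineOpen σ.locus

/-- Two line bundles are isomorphic iff on a common refinement of their trivialising covers
their transition cocycles differ by a coboundary. -/
def EquivLB {X : Scheme.{u}} (L M : LineBundle X) : Prop :=
  ∃ (κ : Type u) (V : κ → X.Opens) (_ : iSup V = ⊤) (a : κ → L.ι) (b : κ → M.ι)
    (ha : ∀ c, V c ≤ L.U (a c)) (hb : ∀ c, V c ≤ M.U (b c)) (s : ∀ c, (Γ(X, V c))ˣ),
    ∀ c c' : κ,
      Units.map (sres X (le_inf ((inf_le_left.trans (ha c)))
          (inf_le_right.trans (ha c')) : V c ⊓ V c' ≤ L.U (a c) ⊓ L.U (a c'))).toMonoidHom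
          (L.t (a c) (a c'))
        * Units.map (sres X (inf_le_right : V c ⊓ V c' ≤ V c')).toMonoidHom (s c')
      = Units.map (sres X (inf_le_left : V c ⊓ V c' ≤ V c)).toMonoidHom (s c)
        * Units.map (sres X (le_inf ((inf_le_left.trans (hb c)))
            (inf_le_right.trans (hb c')))).toMonoidHom (M.t (b c) (b c'))

/-- The canonical algebra map `k → Γ(X, U)` for a scheme `X` over `Spec k`. -/
def toSections {k : Type u} [Field k] {X : Scheme.{u}} (sX : X ⟶ Spec (CommRingCat.of k))
    (U : X.Opens) : k →+* Γ(X, U) :=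
  ((sres X (le_top : U ≤ ⊤)).comp
    ((sX.appTop.hom : Γ(Spec (CommRingCat.of k), ⊤) →+* Γ(X, ⊤)))).comp
    ((Scheme.ΓSpecIso (CommRingCat.of k)).inv : CommRingCat.of k ⟶ _).hom

lemma sres_toSections {k : Type u} [Field k] {X : Scheme.{u}}
    (sX : X ⟶ Spec (CommRingCat.of k)) {V U : X.Opens} (h : V ≤ U) (c : k) :
    sres X h (toSections sX U c) = toSections sX V c := by
  simp only [toSections, RingHom.comp_apply, sres_sres]

/-- The space of global sections of a line bundle on a scheme over `k`, as a `k`-submodule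
of the product of the local section spaces. -/
def secSubmodule {k : Type u} [Field k] {X : Scheme.{u}} (sX : X ⟶ Spec (CommRingCat.of k))
    (L : LineBundle X) :
    letI : ∀ i, Module k Γ(X, L.U i) := fun i => (toSections sX (L.U i)).toModule
    Submodule k (∀ i, Γ(X, L.U i)) :=
  letI : ∀ i, Module k Γ(X, L.U i) := fun i => (toSections sX (L.U i)).toModule
  { carrier := {s | ∀ i j, sres X (inf_le_left : L.U i ⊓ L.U j ≤ L.U i) (s i)
      = (L.t i j : Γ(X, L.U i ⊓ L.U j)) * sres X inf_le_right (s j)}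
    add_mem' := by
      intro s r hs hr i j
      simp only [Pi.add_apply, map_add, hs i j, hr i j, mul_add]
    zero_mem' := by
      intro i j
      simp
    smul_mem' := by
      intro c s hs i j
      show sres X _ (toSections sX (L.U i) c * s i)
        = (L.t i j : Γ(X, L.U i ⊓ L.U j)) * sres X _ (toSections sX (L.U j) c * s j)
      rw [map_mul, map_mul, hs i j, sres_toSections, sres_toSections]
      ring }

/-- The dimension `h⁰(X, L)` of the space of global sections of a line bundle on a scheme
over a field `k`. -/
def h0 {k : Type u} [Field k] {X : Scheme.{u}} (sX : X ⟶ Spec (CommRingCat.of k))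
    (L : LineBundle X) : ℕ :=
  letI : ∀ i, Module k Γ(X, L.U i) := fun i => (toSections sX (L.U i)).toModule
  Module.finrank k (secSubmodule sX L)

lemma sres_appLE (f : X ⟶ Y) {U : Y.Opens} {V V' : X.Opens} (e : V ≤ f ⁻¹ᵁ U)
    (h : V' ≤ V) (a : Γ(Y, U)) :
    sres X h (f.appLE U V e a) = f.appLE U V' (h.trans e) a := by
  rw [show f.appLE U V' (h.trans e)
      = f.appLE U V e ≫ X.presheaf.map (homOfLE h).op from (f.appLE_map e (homOfLE h).op).symm]
  rfl

lemma appLE_sres (f : X ⟶ Y) {U U' : Y.Opens} {V : X.Opens} (e : V ≤ f ⁻¹ᵁ U)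
    (h : U ≤ U') (a : Γ(Y, U')) :
    f.appLE U V e (sres Y h a) = f.appLE U' V (e.trans (preimage_mono f h)) a := by
  rw [show f.appLE U' V (e.trans (preimage_mono f h))
      = Y.presheaf.map (homOfLE h).op ≫ f.appLE U V e from (f.map_appLE e (homOfLE h).op).symm]
  rfl

/-- Pullback of global sections of a line bundle. -/
def pullbackSec (f : X ⟶ Y) (L : LineBundle Y) (σ : GlobalSec L) :
    GlobalSec (pullbackLB f L) where
  s i := f.app (L.U i) (σ.s i)
  compat i j := by
    have key := congrArg (f.appLE (L.U i ⊓ L.U j)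
      (f ⁻¹ᵁ L.U i ⊓ f ⁻¹ᵁ L.U j) (preimage_inf f (L.U i) (L.U j)).ge) (σ.compat i j)
    rw [map_mul, appLE_sres, appLE_sres] at key
    exact key

end LineBundle

attribute [local instance] MvPolynomial.gradedAlgebra

/-- Projective `N`-space over `k`, as the `Proj` of the polynomial ring in `N + 1`
variables with its standard grading. -/
def ProjSpace (k : Type u) [Field k] (N : ℕ) : Scheme.{u} :=
  Proj (MvPolynomial.homogeneousSubmodule (Fin (N + 1)) k)

/-- The inclusion of `k` into the degree-zero part of the polynomial ring. -/
def degreeZeroInclusion (k : Type u) [Field k] (N : ℕ) :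
    k →+* (MvPolynomial.homogeneousSubmodule (Fin (N + 1)) k 0) where
  toFun c := ⟨MvPolynomial.C c, by
    simp [MvPolynomial.mem_homogeneousSubmodule, MvPolynomial.isHomogeneous_C]⟩
  map_one' := by ext; simp
  map_mul' x y := by ext; simp
  map_zero' := by ext; simp
  map_add' x y := by ext; simp

/-- The structure morphism of projective space over `k`. -/
def ProjSpace.str (k : Type u) [Field k] (N : ℕ) :
    ProjSpace k N ⟶ Spec (CommRingCat.of k) :=
  Proj.toSpecZero _ ≫ Spec.map (CommRingCat.ofHom (degreeZeroInclusion k N))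

/-- A scheme over `k` is a projective variety if it is integral and admits a closed
immersion into some projective space over `k`, compatibly with the structure morphisms. -/
def IsProjectiveVariety {k : Type u} [Field k] {X : Scheme.{u}}
    (sX : X ⟶ Spec (CommRingCat.of k)) : Prop :=
  IsIntegral X ∧ ∃ (N : ℕ) (ι : X ⟶ ProjSpace k N),
    IsClosedImmersion ι ∧ ι ≫ ProjSpace.str k N = sX
set_option maxHeartbeats 2000000 in
open LineBundle in
/-- `ω` is a canonical line bundle on the `g`-dimensional smooth variety `X` over `k`:
on its trivialising cover the module of Kähler differentials is free of rank `g`, and the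
transition cocycle of `ω` is given by the determinants of the base-change matrices of the
corresponding bases of differentials, i.e. `ω ≅ det Ω¹_{X/k}`. -/
def IsCanonicalBundle {k : Type u} [Field k] {X : Scheme.{u}}
    (sX : X ⟶ Spec (CommRingCat.of k)) (g : ℕ) (ω : LineBundle X) : Prop :=
  letI : ∀ U : X.Opens, Algebra k Γ(X, U) := fun U => (toSections sX U).toAlgebra
  ∃ e : ∀ i : ω.ι, Module.Basis (Fin g) Γ(X, ω.U i) (Ω[Γ(X, ω.U i)⁄k]),
    ∀ i j : ω.ι,
      letI : Algebra Γ(X, ω.U i) Γ(X, ω.U i ⊓ ω.U j) :=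
        (sres X (inf_le_left : ω.U i ⊓ ω.U j ≤ ω.U i)).toAlgebra
      letI : Algebra Γ(X, ω.U j) Γ(X, ω.U i ⊓ ω.U j) :=
        (sres X (inf_le_right : ω.U i ⊓ ω.U j ≤ ω.U j)).toAlgebra
      haveI : IsScalarTower k Γ(X, ω.U i) Γ(X, ω.U i ⊓ ω.U j) :=
        IsScalarTower.of_algebraMap_eq fun c => (sres_toSections sX _ c).symm
      haveI : IsScalarTower k Γ(X, ω.U j) Γ(X, ω.U i ⊓ ω.U j) :=
        IsScalarTower.of_algebraMap_eq fun c => (sres_toSections sX _ c).symm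
      haveI : SMulCommClass k Γ(X, ω.U i) Γ(X, ω.U i ⊓ ω.U j) :=
        ⟨fun c a b => by
          simp only [Algebra.smul_def, ← mul_assoc, mul_comm]⟩
      haveI : SMulCommClass k Γ(X, ω.U j) Γ(X, ω.U i ⊓ ω.U j) :=
        ⟨fun c a b => by
          simp only [Algebra.smul_def, ← mul_assoc, mul_comm]⟩
      ∃ M : Matrix (Fin g) (Fin g) Γ(X, ω.U i ⊓ ω.U j),
        (∀ a : Fin g,
          KaehlerDifferential.map k k Γ(X, ω.U j) Γ(X, ω.U i ⊓ ω.U j) (e j a)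
            = ∑ b : Fin g, M a b •
              KaehlerDifferential.map k k Γ(X, ω.U i) Γ(X, ω.U i ⊓ ω.U j) (e i b)) ∧
        (ω.t i j : Γ(X, ω.U i ⊓ ω.U j)) = M.det

/-- A self-map of an integral scheme is separable if it fixes the generic point and the
induced extension of function fields is separable. -/
def IsSeparableSelfMap {X : Scheme.{u}} [IsIntegral X] (φ : X ⟶ X) : Prop :=
  ∃ h : φ.base (genericPoint X) = genericPoint X,
    letI E : X.functionField ⟶ X.functionField :=
      (X.presheaf.stalkCongr (Inseparable.of_eq h.symm)).hom ≫ φ.stalkMap (genericPoint X)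
    letI : Algebra X.functionField X.functionField := (E.hom : _ →+* _).toAlgebra
    Algebra.IsSeparable X.functionField X.functionField

/-- A finite extension of domains admits an `A`-linear matrix representation, multiplicative up to
a nonzero denominator. -/
lemma exists_matrix_rep (A B : Type*) [CommRing A] [IsDomain A] [CommRing B] [IsDomain B]
    [Algebra A B] [Module.Finite A B] [FaithfulSMul A B] :
    ∃ (r : ℕ) (c : A) (μ : B →ₗ[A] Matrix (Fin r) (Fin r) A), 0 < r ∧ c ≠ 0 ∧
      (∀ g h, c • μ (g * h) = μ g * μ h) ∧ ∀ g, g ≠ 0 → (μ g).det ≠ 0 := by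
  classical
  let L := FractionRing A
  let M := FractionRing B
  letI : Algebra L M := FractionRing.liftAlgebra A M
  haveI : IsScalarTower A L M := FractionRing.isScalarTower_liftAlgebra A M
  haveI : Module.Finite L M := .of_isLocalization A B (nonZeroDivisors A)
  let b := Module.finBasis L M
  let ρ := Algebra.leftMulMatrix b
  obtain ⟨S, hS⟩ := (Module.Finite.fg_top : (⊤ : Submodule A B).FG)
  obtain ⟨⟨c, hc⟩, hc'⟩ := IsLocalization.exist_integer_multiples (nonZeroDivisors A)
    (S ×ˢ (Finset.univ : Finset (Fin (Module.finrank L M) × Fin (Module.finrank L M))))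
    (fun p => ρ (algebraMap B M p.1) p.2.1 p.2.2)
  have hinj : Function.Injective (algebraMap A L) := IsFractionRing.injective A L
  have hρ : ∀ (a : A) (x : B), ρ (algebraMap B M (a • x)) =
      algebraMap A L a • ρ (algebraMap B M x) := by
    intro a x
    rw [Algebra.smul_def, map_mul, ← IsScalarTower.algebraMap_apply A B M,
        IsScalarTower.algebraMap_apply A L M, map_mul, AlgHom.commutes, ← Algebra.smul_def]
  have key : ∀ g : B, ∃ N : Matrix (Fin (Module.finrank L M)) (Fin (Module.finrank L M)) A,
      N.map (algebraMap A L) = algebraMap A L c • ρ (algebraMap B M g) := by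
    intro g
    have hg : g ∈ Submodule.span A (S : Set B) := by rw [hS]; trivial
    induction hg using Submodule.span_induction with
    | mem x hx =>
      have : ∀ i j, ∃ a : A, algebraMap A L a = algebraMap A L c * ρ (algebraMap B M x) i j := by
        intro i j
        obtain ⟨a, ha⟩ := hc' (x, (i, j)) (by simpa using hx)
        exact ⟨a, by rw [ha, Algebra.smul_def]⟩
      choose N hN using this
      exact ⟨Matrix.of N, by ext i j; simp [hN]⟩
    | zero => exact ⟨0, by ext; simp⟩
    | add x y _ _ hx hy =>
      obtain ⟨N, hN⟩ := hx
      obtain ⟨N', hN'⟩ := hy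
      refine ⟨N + N', ?_⟩
      rw [Matrix.map_add _ (map_add _), hN, hN', map_add, map_add, smul_add]
    | smul a x _ hx =>
      obtain ⟨N, hN⟩ := hx
      refine ⟨a • N, ?_⟩
      have : (a • N).map (algebraMap A L) = algebraMap A L a • N.map (algebraMap A L) := by
        ext i j; simp
      rw [this, hN, hρ, smul_comm]
  choose N hN using key
  have hinj' : Function.Injective (fun N : Matrix (Fin (Module.finrank L M))
      (Fin (Module.finrank L M)) A => N.map (algebraMap A L)) :=
    fun N N' h => Matrix.map_injective hinj h
  have hc0 : c ≠ 0 := nonZeroDivisors.ne_zero hc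
  refine ⟨Module.finrank L M, c, { toFun := N, map_add' := ?_, map_smul' := ?_ },
    Module.finrank_pos, hc0, ?_, ?_⟩
  · intro x y
    apply hinj'
    simp only
    rw [Matrix.map_add _ (map_add _), hN, hN, hN, map_add, map_add, smul_add]
  · intro a x
    apply hinj'
    have : (a • N x).map (algebraMap A L) = algebraMap A L a • (N x).map (algebraMap A L) := by
      ext i j; simp
    simp only [RingHom.id_apply]
    rw [this, hN, hN, hρ, smul_comm]
  · intro g h
    apply hinj'
    have : (c • N (g * h)).map (algebraMap A L) =
        algebraMap A L c • (N (g * h)).map (algebraMap A L) := by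
      ext i j; simp
    simp only [LinearMap.coe_mk, AddHom.coe_mk]
    rw [this, hN, Matrix.map_mul, hN, hN, map_mul, map_mul, smul_mul_smul_comm, smul_smul]
  · intro g hg h0
    have h1 : ((N g).map (algebraMap A L)).det = 0 := by
      have := RingHom.map_det (algebraMap A L) (N g)
      simp only [LinearMap.coe_mk, AddHom.coe_mk] at h0
      rw [h0, map_zero] at this
      exact this.symm
    rw [hN, Matrix.det_smul] at h1
    have h2 : (ρ (algebraMap B M g)).det ≠ 0 := by
      have hu : IsUnit (algebraMap B M g) := by
        rw [isUnit_iff_ne_zero]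
        intro h
        exact hg ((IsFractionRing.injective B M) (by rw [h, map_zero]))
      exact ((Matrix.isUnit_iff_isUnit_det _).1 (hu.map ρ)).ne_zero
    refine mul_ne_zero (pow_ne_zero _ ?_) h2 h1
    intro h
    exact hc0 (hinj (by rw [h, map_zero]))

lemma matrix_det_totalDegree_le {σ k : Type*} [Field k] {r d : ℕ}
    (N : Matrix (Fin r) (Fin r) (MvPolynomial σ k)) (hN : ∀ i j, (N i j).totalDegree ≤ d) :
    N.det.totalDegree ≤ r * d := by
  rw [Matrix.det_apply]
  refine MvPolynomial.totalDegree_finsetSum_le fun τ _ => ?_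
  refine le_trans (b := (∏ i, N (τ i) i).totalDegree) ?_ ?_
  · rcases Int.units_eq_one_or (Equiv.Perm.sign τ) with h | h <;> simp [h]
  · refine (MvPolynomial.totalDegree_finsetProd _ _).trans ?_
    refine (Finset.sum_le_sum fun i _ => hN (τ i) i).trans ?_
    simp

lemma matrix_mul_totalDegree_le {σ k : Type*} [Field k] {r d d' : ℕ}
    (N N' : Matrix (Fin r) (Fin r) (MvPolynomial σ k)) (hN : ∀ i j, (N i j).totalDegree ≤ d)
    (hN' : ∀ i j, (N' i j).totalDegree ≤ d') (i j : Fin r) :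
    ((N * N') i j).totalDegree ≤ d + d' := by
  rw [Matrix.mul_apply]
  exact MvPolynomial.totalDegree_finsetSum_le fun l _ =>
    (MvPolynomial.totalDegree_mul _ _).trans (add_le_add (hN _ _) (hN' _ _))

lemma mvPolynomial_mem_trunc_sup {k : Type*} [Field k] {s : ℕ} (m : ℕ)
    (p : MvPolynomial (Fin s) k) :
    p ∈ MvPolynomial.restrictTotalDegree (Fin s) k m ⊔
      (MvPolynomial.idealOfVars (Fin s) k ^ m).restrictScalars k := by
  rw [p.as_sum]
  refine Submodule.sum_mem _ fun x _ => ?_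
  rcases le_total (Finsupp.degree x) m with h | h
  · refine Submodule.mem_sup_left ?_
    rw [MvPolynomial.mem_restrictTotalDegree]
    refine (MvPolynomial.totalDegree_monomial_le _ _).trans ?_
    exact h
  · refine Submodule.mem_sup_right ?_
    rw [Submodule.restrictScalars_mem, MvPolynomial.mem_pow_idealOfVars_iff]
    intro y hy
    have := MvPolynomial.support_monomial_subset hy
    simp only [Finset.mem_singleton] at this
    rw [this]; exact h

/-- A space of elements of a finitely generated domain whose powers grow linearly with respect to
the filtration by powers of `F` is finite-dimensional. -/
lemma finite_of_pow_mem {k B : Type*} [Field k] [CommRing B] [IsDomain B] [Algebra k B]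
    [Algebra.FiniteType k B] (F : Submodule k B) (hF : F.FG) (e : ℕ) (V : Submodule k B)
    (hV : ∀ f ∈ V, ∃ T, ∀ q, f ^ q ∈ F ^ (T + q * e)) : Module.Finite k V := by
  classical
  obtain ⟨s, φ, hφ, hfin⟩ := exists_finite_inj_algHom_of_fg k B
  letI : Algebra (MvPolynomial (Fin s) k) B := φ.toRingHom.toAlgebra
  haveI : Module.Finite (MvPolynomial (Fin s) k) B := hfin
  haveI : IsScalarTower k (MvPolynomial (Fin s) k) B :=
    IsScalarTower.of_algebraMap_eq fun c => (φ.commutes c).symm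
  haveI : FaithfulSMul (MvPolynomial (Fin s) k) B := (faithfulSMul_iff_algebraMap_injective _ _).2 hφ
  obtain ⟨r, c, μ, hr, hc, hmul, hdet⟩ := exists_matrix_rep (MvPolynomial (Fin s) k) B
  -- entries of the matrices of elements of `F` have bounded degree
  obtain ⟨D, hD⟩ : ∃ D, ∀ z ∈ F, ∀ i j, (μ z i j).totalDegree ≤ D := by
    obtain ⟨S, hS⟩ := hF
    refine ⟨S.sup fun z => Finset.univ.sup fun i => Finset.univ.sup fun j => (μ z i j).totalDegree,
      fun z hz => ?_⟩
    rw [← hS] at hz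
    induction hz using Submodule.span_induction with
    | mem x hx =>
      intro i j
      refine le_trans ?_ (Finset.le_sup (f := fun z => Finset.univ.sup fun i =>
        Finset.univ.sup fun j => (μ z i j).totalDegree) hx)
      refine le_trans ?_ (Finset.le_sup (f := fun i =>
        Finset.univ.sup fun j => (μ x i j).totalDegree) (Finset.mem_univ i))
      exact Finset.le_sup (f := fun j => (μ x i j).totalDegree) (Finset.mem_univ j)
    | zero => simp
    | add x y _ _ hx hy =>
      intro i j
      rw [map_add, Matrix.add_apply]
      exact (MvPolynomial.totalDegree_add _ _).trans (max_le (hx i j) (hy i j))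
    | smul a x _ hx =>
      intro i j
      have : a • x = (MvPolynomial.C a : MvPolynomial (Fin s) k) • x := by
        rw [← MvPolynomial.algebraMap_eq, algebraMap_smul]
      rw [this, map_smul, Matrix.smul_apply, smul_eq_mul, ← MvPolynomial.smul_eq_C_mul]
      exact (MvPolynomial.totalDegree_smul_le _ _).trans (hx i j)
  obtain ⟨D', hD'⟩ : ∃ D', ∀ i j, (μ 1 i j).totalDegree ≤ D' := by
    refine ⟨Finset.univ.sup fun i => Finset.univ.sup fun j => (μ 1 i j).totalDegree,
      fun i j => ?_⟩
    refine le_trans ?_ (Finset.le_sup (f := fun i =>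
        Finset.univ.sup fun j => (μ 1 i j).totalDegree) (Finset.mem_univ i))
    exact Finset.le_sup (f := fun j => (μ 1 i j).totalDegree) (Finset.mem_univ j)
  have claim1 : ∀ m, ∀ g ∈ F ^ m, ∀ i j, ((c ^ m • μ g) i j).totalDegree ≤ D * m + D' := by
    intro m
    induction m with
    | zero =>
      intro g hg i j
      rw [pow_zero, Submodule.mem_one] at hg
      obtain ⟨a, rfl⟩ := hg
      have : algebraMap k B a = (MvPolynomial.C a : MvPolynomial (Fin s) k) • (1 : B) := by
        rw [← MvPolynomial.algebraMap_eq, algebraMap_smul, Algebra.algebraMap_eq_smul_one]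
      rw [this, map_smul, pow_zero, one_smul, Matrix.smul_apply, smul_eq_mul,
        ← MvPolynomial.smul_eq_C_mul]
      simpa using (MvPolynomial.totalDegree_smul_le _ _).trans (hD' i j)
    | succ m ih =>
      intro g hg
      rw [pow_succ'] at hg
      induction hg using Submodule.mul_induction_on' with
      | mem_mul_mem z hz g hg =>
        have : c ^ (m + 1) • μ (z * g) = μ z * (c ^ m • μ g) := by
          rw [pow_succ, mul_smul, hmul, Matrix.mul_smul]
        intro i j
        rw [this]
        refine (matrix_mul_totalDegree_le _ _ (hD z hz) (ih g hg) i j).trans ?_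
        linarith
      | add x _ y _ hx hy =>
        intro i j
        rw [map_add, smul_add, Matrix.add_apply]
        exact (MvPolynomial.totalDegree_add _ _).trans (max_le (hx i j) (hy i j))
  have claim2 : ∀ (f : B) (q : ℕ), c ^ q • μ (f ^ (q + 1)) = μ f ^ (q + 1) := by
    intro f q
    induction q with
    | zero => simp
    | succ q ih =>
      rw [pow_succ c, mul_smul, pow_succ f (q + 1), hmul, ← Matrix.smul_mul, ih, ← pow_succ]
  set b := r * c.totalDegree + r * D * e with hb
  have bound : ∀ f ∈ V, (μ f).det.totalDegree ≤ b := by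
    intro f hf
    by_cases hf0 : f = 0
    · haveI := Fin.pos_iff_nonempty.1 hr
      rw [hf0, map_zero, Matrix.det_zero]; simp
    obtain ⟨T, hT⟩ := hV f hf
    have hP := hdet f hf0
    have hcd : ∀ n, (c ^ n).totalDegree ≤ n * c.totalDegree := fun n =>
      MvPolynomial.totalDegree_pow _ _
    have key : ∀ q, (q + 1) * (μ f).det.totalDegree ≤
        q * r * c.totalDegree + r * (D * (T + (q + 1) * e) + D') := by
      intro q
      have h1 := matrix_det_totalDegree_le _ (claim1 _ _ (hT (q + 1)))
      have h2 : c ^ (q * r) * (c ^ (T + (q + 1) * e) • μ (f ^ (q + 1))).det =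
          c ^ ((T + (q + 1) * e) * r) * (μ f).det ^ (q + 1) := by
        have := congrArg Matrix.det (congrArg (fun N => c ^ (T + (q + 1) * e) • N) (claim2 f q))
        rw [smul_comm] at this
        simpa only [Matrix.det_smul, Matrix.det_pow, pow_mul, Fintype.card_fin] using this
      have hdeg : ∀ n, ((μ f).det ^ n).totalDegree = n * (μ f).det.totalDegree := by
        intro n
        induction n with
        | zero => simp
        | succ n ih =>
          rw [pow_succ, MvPolynomial.totalDegree_mul_of_isDomain (pow_ne_zero _ hP) hP, ih]; ring
      have h3 := congrArg MvPolynomial.totalDegree h2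
      rw [MvPolynomial.totalDegree_mul_of_isDomain (pow_ne_zero _ hc) (pow_ne_zero _ hP), hdeg] at h3
      have h4 := MvPolynomial.totalDegree_mul (c ^ (q * r))
        (c ^ (T + (q + 1) * e) • μ (f ^ (q + 1))).det
      have h5 := hcd (q * r)
      omega
    by_contra hlt
    push Not at hlt
    have := key (r * D * T + r * D')
    generalize (μ f).det.totalDegree = x at *
    have h6 : (r * D * T + r * D' + 1) * (b + 1) ≤ (r * D * T + r * D' + 1) * x :=
      Nat.mul_le_mul_left _ hlt
    have h7 := h6.trans this
    rw [hb] at h7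
    ring_nf at h7
    nlinarith [Nat.zero_le (r * c.totalDegree)]
  -- elements in a high power of the ideal vanish
  let I : Ideal B := (MvPolynomial.idealOfVars (Fin s) k ^ (b + 1)).map
    (algebraMap (MvPolynomial (Fin s) k) B)
  have hI : ∀ f ∈ V, f ∈ I → f = 0 := by
    intro f hf hfI
    by_contra hf0
    have hP := hdet f hf0
    have hent : ∀ i j, μ f i j ∈ MvPolynomial.idealOfVars (Fin s) k ^ (b + 1) := by
      have hfI' : f ∈ (MvPolynomial.idealOfVars (Fin s) k ^ (b + 1)) •
          (⊤ : Submodule (MvPolynomial (Fin s) k) B) := by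
        rw [Ideal.smul_top_eq_map]; exact hfI
      have : ∀ x ∈ (MvPolynomial.idealOfVars (Fin s) k ^ (b + 1)) •
          (⊤ : Submodule (MvPolynomial (Fin s) k) B), ∀ i j,
          μ x i j ∈ MvPolynomial.idealOfVars (Fin s) k ^ (b + 1) := by
        intro x hx
        refine Submodule.smul_induction_on hx ?_ ?_
        · intro a ha x _ i j
          rw [map_smul, Matrix.smul_apply, smul_eq_mul]
          exact Ideal.mul_mem_right _ _ ha
        · intro x y hx hy i j
          rw [map_add, Matrix.add_apply]
          exact Submodule.add_mem _ (hx i j) (hy i j)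
      exact this f hfI'
    have hmem : (μ f).det ∈ MvPolynomial.idealOfVars (Fin s) k ^ (b + 1) := by
      rw [Matrix.det_apply]
      refine Submodule.sum_mem _ fun τ _ => ?_
      refine Submodule.smul_of_tower_mem _ _ ?_
      exact Ideal.prod_mem _ (Finset.mem_univ (⟨0, hr⟩ : Fin r)) (hent _ _)
    rw [MvPolynomial.mem_pow_idealOfVars_iff] at hmem
    obtain ⟨x, hx⟩ := MvPolynomial.support_nonempty.2 hP
    have h1 := hmem x hx
    have h2 := MvPolynomial.le_totalDegree hx
    have h3 := bound f hf
    have : Finsupp.degree x = x.sum fun _ e => e := rfl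
    omega
  haveI : Module.Finite k (B ⧸ I) := by
    obtain ⟨S, hS⟩ := (Module.Finite.fg_top : (⊤ : Submodule (MvPolynomial (Fin s) k) B).FG)
    let P := MvPolynomial.restrictTotalDegree (Fin s) k (b + 1)
    let χ : (S → P) →ₗ[k] (B ⧸ I) := (Ideal.Quotient.mkₐ k I).toLinearMap.comp
      (∑ x : S, (LinearMap.toSpanSingleton (MvPolynomial (Fin s) k) B
        (x : B)).restrictScalars k ∘ₗ P.subtype ∘ₗ LinearMap.proj x)
    refine Module.Finite.of_surjective χ fun y => ?_
    obtain ⟨y, rfl⟩ := Ideal.Quotient.mk_surjective y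
    have hy : y ∈ Submodule.span (MvPolynomial (Fin s) k) (S : Set B) := by rw [hS]; trivial
    obtain ⟨a, -, rfl⟩ := Submodule.mem_span_finset.1 hy
    choose p hp q hq hpq using fun x => Submodule.mem_sup.1 (mvPolynomial_mem_trunc_sup (b + 1) (a x))
    refine ⟨fun x => ⟨p x, hp x⟩, ?_⟩
    have h1 : χ (fun x => ⟨p x, hp x⟩) = Ideal.Quotient.mk I (∑ x : S, p x • (x : B)) := by
      simp [χ, P]
    rw [h1, Finset.sum_coe_sort S (fun x => p x • x), Ideal.Quotient.eq, ← Finset.sum_sub_distrib]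
    refine Submodule.sum_mem _ fun x _ => ?_
    rw [← sub_smul, ← hpq x, sub_add_cancel_left, neg_smul, neg_mem_iff, Algebra.smul_def]
    exact Ideal.mul_mem_right _ _ (Ideal.mem_map_of_mem _ (hq x))
  let ψ : V →ₗ[k] (B ⧸ I) := (Ideal.Quotient.mkₐ k I).toLinearMap.comp V.subtype
  refine Module.Finite.of_injective ψ ?_
  rw [← LinearMap.ker_eq_bot, LinearMap.ker_eq_bot']
  rintro ⟨f, hf⟩ h
  have : f ∈ I := Ideal.Quotient.eq_zero_iff_mem.1 h
  exact Subtype.ext (hI f hf this)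

section
variable {k K : Type*} [Field k] [Field K] [Algebra k K]

open scoped Pointwise in
lemma mem_range_pow_iff_prod {N : ℕ} (z : Fin N → K) (T : ℕ) (g : K) (hg : g ∈ Set.range z ^ T) :
    ∃ σ : Fin T → Fin N, g = ∏ t, z (σ t) := by
  induction T generalizing g with
  | zero => exact ⟨Fin.elim0, by simpa using hg⟩
  | succ T ih =>
    rw [pow_succ'] at hg
    obtain ⟨_, ⟨i, rfl⟩, y, hy, rfl⟩ := Set.mem_mul.1 hg
    obtain ⟨σ, rfl⟩ := ih y hy
    exact ⟨Fin.cons i σ, by simp [Fin.prod_univ_succ]⟩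

lemma pow_mem_pow_of_charts {N : ℕ} (z : Fin N → K) (h1 : (1 : K) ∈ Submodule.span k (Set.range z))
    (f : K) (e : ℕ)
    (hf : ∀ j, ∃ a, f * z j ^ a ∈ Submodule.span k (Set.range z) ^ (e + a)) :
    ∃ T, ∀ q, f ^ q ∈ Submodule.span k (Set.range z) ^ (T + q * e) := by
  set F := Submodule.span k (Set.range z) with hF
  have hzF : ∀ j, z j ∈ F := fun j => Submodule.subset_span ⟨j, rfl⟩
  have hmul : ∀ {m n : ℕ} {x y : K}, x ∈ F ^ m → y ∈ F ^ n → x * y ∈ F ^ (m + n) := by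
    intro m n x y hx hy
    rw [pow_add]; exact Submodule.mul_mem_mul hx hy
  have hpow : ∀ {x : K} (n : ℕ), x ∈ F → x ^ n ∈ F ^ n := fun n hx => Submodule.pow_mem_pow F hx n
  have h1n : ∀ n, (1 : K) ∈ F ^ n := fun n => by simpa using hpow n h1
  choose a ha using hf
  let A := Finset.univ.sup a
  have hA : ∀ j, ∀ n, A ≤ n → f * z j ^ n ∈ F ^ (e + n) := by
    intro j n hn
    have hj : a j ≤ n := (Finset.le_sup (Finset.mem_univ j)).trans hn
    have := hmul (ha j) (hpow (n - a j) (hzF j))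
    rw [mul_assoc, ← pow_add] at this
    rwa [Nat.add_sub_of_le hj, add_assoc, Nat.add_sub_of_le hj] at this
  have hT : ∀ g ∈ F ^ (N * A + 1), f * g ∈ F ^ (e + (N * A + 1)) := by
    intro g hg
    rw [hF, Submodule.span_pow] at hg
    induction hg using Submodule.span_induction with
    | mem x hx =>
      obtain ⟨σ, rfl⟩ := mem_range_pow_iff_prod z _ x hx
      obtain ⟨j, hj⟩ := Fintype.exists_lt_card_fiber_of_mul_lt_card σ (n := A) (by simp)
      rw [← Finset.prod_filter_mul_prod_filter_not Finset.univ (fun t => σ t = j)]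
      have e1 : ∏ t with σ t = j, z (σ t) = z j ^ (Finset.univ.filter (fun t => σ t = j)).card := by
        rw [Finset.prod_congr rfl (g := fun _ => z j), Finset.prod_const]
        intro t ht
        rw [(Finset.mem_filter.1 ht).2]
      have e2 : ∀ s : Finset (Fin (N * A + 1)), ∏ t ∈ s, z (σ t) ∈ F ^ s.card := by
        intro s
        induction s using Finset.induction_on with
        | empty => simp
        | insert x s hx ih =>
          rw [Finset.prod_insert hx, Finset.card_insert_of_notMem hx, pow_succ']
          exact Submodule.mul_mem_mul (hzF _) ih
      rw [e1, ← mul_assoc]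
      have := hmul (hA j _ hj.le) (e2 (Finset.univ.filter (fun t => ¬ σ t = j)))
      have hcard := Finset.card_filter_add_card_filter_not
        (s := (Finset.univ : Finset (Fin (N * A + 1)))) (fun t => σ t = j)
      rw [add_assoc, hcard] at this
      simpa using this
    | zero => simp
    | add x y _ _ hx hy => rw [mul_add]; exact Submodule.add_mem _ hx hy
    | smul c x _ hx => rw [mul_smul_comm]; exact Submodule.smul_mem _ _ hx
  refine ⟨N * A + 1, fun q => ?_⟩
  suffices H : ∀ q, ∀ g ∈ F ^ (N * A + 1), f ^ q * g ∈ F ^ (N * A + 1 + q * e) by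
    simpa using H q 1 (h1n _)
  intro q
  induction q with
  | zero => intro g hg; simpa using hg
  | succ q ih =>
    intro g hg
    have h2 := ih g hg
    rw [pow_succ', mul_assoc]
    rw [pow_add] at h2
    have : N * A + 1 + (q + 1) * e = (e + (N * A + 1)) + q * e := by ring
    rw [this]
    refine Submodule.mul_induction_on h2 (fun x hx y hy => ?_) (fun x y hx hy => ?_)
    · rw [← mul_assoc]
      exact hmul (hT x hx) hy
    · rw [mul_add]; exact Submodule.add_mem _ hx hy

/-- A space of elements of `K` which, on each standard chart of a projective model with homogeneous
coordinates `z`, has bounded denominators, is finite-dimensional. -/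
lemma finite_of_charts {N : ℕ} (z : Fin N → K) (j₀ : Fin N) (hz : z j₀ = 1) (V : Submodule k K)
    (hV : ∀ j, z j ≠ 0 → ∃ c ≠ 0, c ∈ Algebra.adjoin k (Set.range fun i => z i / z j) ∧
      ∀ v ∈ V, c * v ∈ Algebra.adjoin k (Set.range fun i => z i / z j)) :
    Module.Finite k V := by
  classical
  set F := Submodule.span k (Set.range z) with hF
  have hzF : ∀ j, z j ∈ F := fun j => Submodule.subset_span ⟨j, rfl⟩
  have h1 : (1 : K) ∈ F := hz ▸ hzF j₀
  have hmul : ∀ {m n : ℕ} {x y : K}, x ∈ F ^ m → y ∈ F ^ n → x * y ∈ F ^ (m + n) := by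
    intro m n x y hx hy
    rw [pow_add]; exact Submodule.mul_mem_mul hx hy
  have hpow : ∀ {x : K} (n : ℕ), x ∈ F → x ^ n ∈ F ^ n := fun n hx => Submodule.pow_mem_pow F hx n
  have hchart : ∀ j, z j ≠ 0 → ∀ f ∈ Algebra.adjoin k (Set.range fun i => z i / z j),
      ∃ a, f * z j ^ a ∈ F ^ a := by
    intro j hj f hf
    have hup : ∀ {f : K} {a n : ℕ}, a ≤ n → f * z j ^ a ∈ F ^ a → f * z j ^ n ∈ F ^ n := by
      intro f a n hn h
      have := hmul h (hpow (n - a) (hzF j))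
      rwa [mul_assoc, ← pow_add, Nat.add_sub_of_le hn] at this
    induction hf using Algebra.adjoin_induction with
    | mem x hx =>
      obtain ⟨i, rfl⟩ := hx
      refine ⟨1, ?_⟩
      simpa [hj] using hzF i
    | algebraMap c =>
      refine ⟨0, ?_⟩
      simp only [pow_zero, mul_one]
      exact Submodule.algebraMap_mem c
    | add x y _ _ hx hy =>
      obtain ⟨a, ha⟩ := hx
      obtain ⟨b, hb⟩ := hy
      refine ⟨max a b, ?_⟩
      rw [add_mul]
      exact Submodule.add_mem _ (hup (le_max_left a b) ha) (hup (le_max_right a b) hb)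
    | mul x y _ _ hx hy =>
      obtain ⟨a, ha⟩ := hx
      obtain ⟨b, hb⟩ := hy
      refine ⟨a + b, ?_⟩
      have := hmul ha hb
      rwa [mul_mul_mul_comm, ← pow_add] at this
  have hloc : ∀ j, ∃ h : K, ∃ e : ℕ, h ≠ 0 ∧ h ∈ F ^ e ∧
      ∀ v ∈ V, ∃ a, h * v * z j ^ a ∈ F ^ (e + a) := by
    intro j
    by_cases hj : z j = 0
    · exact ⟨1, 0, one_ne_zero, by simp, fun v _ => ⟨1, by simp [hj]⟩⟩
    · obtain ⟨c, hc0, hc, hcv⟩ := hV j hj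
      obtain ⟨e, he⟩ := hchart j hj c hc
      refine ⟨c * z j ^ e, e, mul_ne_zero hc0 (pow_ne_zero _ hj), he, fun v hv => ?_⟩
      obtain ⟨a, ha⟩ := hchart j hj _ (hcv v hv)
      refine ⟨a, ?_⟩
      have := hmul (hpow e (hzF j)) ha
      convert this using 1
      ring
  choose h e hh0 hhe hhv using hloc
  have hf : ∀ v ∈ V, ∃ T, ∀ q, ((∏ j, h j) * v) ^ q ∈ F ^ (T + q * ∑ j, e j) := by
    intro v hv
    refine pow_mem_pow_of_charts z h1 _ _ fun j => ?_
    obtain ⟨a, ha⟩ := hhv j v hv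
    refine ⟨a, ?_⟩
    have hprod : ∀ s : Finset (Fin N), ∏ i ∈ s, h i ∈ F ^ (∑ i ∈ s, e i) := by
      intro s
      induction s using Finset.induction_on with
      | empty => simp
      | insert x s hx ih =>
        rw [Finset.prod_insert hx, Finset.sum_insert hx]
        exact hmul (hhe _) ih
    have := hmul (hprod (Finset.univ.erase j)) ha
    rw [← Finset.mul_prod_erase _ _ (Finset.mem_univ j), ← Finset.add_sum_erase _ _ (Finset.mem_univ j)]
    generalize ∏ i ∈ Finset.univ.erase j, h i = P at *
    rw [show h j * P * v * z j ^ a = P * (h j * v * z j ^ a) by ring, add_right_comm, add_comm,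
      ← add_assoc, add_right_comm, add_assoc, add_comm a]
    exact this
  let B := Algebra.adjoin k (Set.range z)
  have hFB : ∀ m, F ^ m ≤ Subalgebra.toSubmodule B := by
    intro m
    have hle : F ≤ Subalgebra.toSubmodule B :=
      Submodule.span_le.2 Algebra.subset_adjoin
    induction m with
    | zero => rw [pow_zero]; intro x hx; obtain ⟨c, rfl⟩ := Submodule.mem_one.1 hx; exact B.algebraMap_mem c
    | succ m ih =>
      rw [pow_succ]
      exact Submodule.mul_le.2 fun x hx y hy => B.mul_mem (ih hx) (hle hy)
  let F' : Submodule k B := Submodule.span k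
    (Set.range fun i => (⟨z i, Algebra.subset_adjoin ⟨i, rfl⟩⟩ : B))
  have hF' : ∀ m, (F' ^ m).map B.val.toLinearMap = F ^ m := by
    intro m
    rw [Submodule.map_pow, Submodule.map_span, ← Set.range_comp]
    rfl
  let H : K →ₗ[k] K := LinearMap.mulLeft k (∏ j, h j)
  let V' : Submodule k B := (V.map H).comap B.val.toLinearMap
  have hVB : ∀ v ∈ V, (∏ j, h j) * v ∈ B := by
    intro v hv
    obtain ⟨T, hT⟩ := hf v hv
    have := hT 1
    rw [pow_one] at this
    exact hFB _ this
  haveI : Algebra.FiniteType k B :=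
    B.fg_iff_finiteType.1 (Subalgebra.fg_def.2 ⟨_, Set.finite_range z, rfl⟩)
  haveI : Module.Finite k V' := by
    refine finite_of_pow_mem F' (Submodule.fg_span (Set.finite_range _)) (∑ j, e j) V' ?_
    intro f hfV
    obtain ⟨v, hv, hvf⟩ := hfV
    obtain ⟨T, hT⟩ := hf v hv
    refine ⟨T, fun q => ?_⟩
    have := hT q
    rw [← hF'] at this
    obtain ⟨x, hx, hx'⟩ := this
    have : f ^ q = x := by
      apply Subtype.ext
      rw [SubmonoidClass.coe_pow]
      have h3 : (∏ j, h j) * v = (f : K) := hvf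
      rw [← h3]
      exact hx'.symm
    rw [this]; exact hx
  let ψ : V →ₗ[k] V' :=
    { toFun := fun v => ⟨⟨(∏ j, h j) * v, hVB v v.2⟩, ⟨v, v.2, rfl⟩⟩
      map_add' := fun x y => by ext; simp [mul_add]
      map_smul' := fun c x => by ext; simp }
  refine Module.Finite.of_injective ψ fun x y hxy => ?_
  have h4 : (∏ j, h j) * (x : K) = (∏ j, h j) * y := congrArg (fun t : V' => ((t : B) : K)) hxy
  exact Subtype.ext (mul_left_cancel₀ (Finset.prod_ne_zero_iff.2 fun j _ => hh0 j) h4)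
end

section
open TopologicalSpace

lemma exists_finite_generic {X : Type*} [TopologicalSpace X] [NoetherianSpace X] [QuasiSober X]
    {B : Set X} (hB : IsClosed B) :
    ∃ G : Set X, G.Finite ∧ G ⊆ B ∧ ∀ x ∈ B, ∃ g ∈ G, g ⤳ x := by
  obtain ⟨S, hSf, hSc, hSi, rfl⟩ := NoetherianSpace.exists_finite_set_isClosed_irreducible hB
  have H : ∀ t : S, ∃ g, IsGenericPoint g (t : Set X) := fun t =>
    QuasiSober.sober (hSi t t.2) (hSc t t.2)
  choose g hg using H
  haveI := hSf.to_subtype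
  refine ⟨Set.range g, Set.finite_range g, ?_, ?_⟩
  · rintro _ ⟨t, rfl⟩
    exact ⟨t, t.2, (hg t).mem⟩
  · rintro x ⟨t, ht, hx⟩
    exact ⟨g ⟨t, ht⟩, ⟨_, rfl⟩, (hg ⟨t, ht⟩).specializes hx⟩

lemma preimage_eq_of_preimage_subset {X : Type*} [TopologicalSpace X] [NoetherianSpace X]
    {φ : X → X} (hφ : Continuous φ) (hs : Function.Surjective φ) {B : Set X} (hB : IsClosed B)
    (h : φ ⁻¹' B ⊆ B) : φ ⁻¹' B = B := by
  let C : ℕ → Closeds X := fun m => ⟨φ^[m] ⁻¹' B, hB.preimage (hφ.iterate m)⟩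
  have hanti : Antitone C := by
    refine antitone_nat_of_succ_le fun m => ?_
    intro x hx
    have hx' : φ^[m + 1] x ∈ B := hx
    rw [Function.iterate_succ_apply'] at hx'
    exact h hx'
  obtain ⟨n, hn⟩ := WellFoundedGT.monotone_chain_condition
    (⟨fun m => OrderDual.toDual (C m), fun a b hab => hanti hab⟩ : ℕ →o (Closeds X)ᵒᵈ)
  refine h.antisymm fun y hy => ?_
  obtain ⟨x, rfl⟩ := hs.iterate n y
  have e : C n = C (n + 1) := hn (n + 1) n.le_succ
  have : x ∈ (C (n + 1) : Set X) := by rw [← e]; exact hy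
  have hx' : φ^[n + 1] x ∈ B := this
  rw [Function.iterate_succ_apply'] at hx'
  exact hx'

lemma exists_periodic_of_maximal {X : Type*} [TopologicalSpace X] [NoetherianSpace X]
    [QuasiSober X] [T0Space X]
    {φ : X → X} (hφ : Continuous φ) (hs : Function.Surjective φ) {B : Set X} (hB : IsClosed B)
    (h : φ ⁻¹' B ⊆ B) {y : X} (hy : y ∈ B) (hmax : ∀ z ∈ B, z ⤳ y → z = y) :
    ∃ r, 0 < r ∧ φ^[r] y = y := by
  have heq := preimage_eq_of_preimage_subset hφ hs hB h
  obtain ⟨G, hGf, hGB, hG⟩ := exists_finite_generic hB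
  let S : Set X := {y | y ∈ B ∧ ∀ z ∈ B, z ⤳ y → z = y}
  have hSG : S ⊆ G := by
    intro y hy
    obtain ⟨g, hg, hgy⟩ := hG y hy.1
    rw [← hy.2 g (hGB hg) hgy]
    exact hg
  have hSf : S.Finite := hGf.subset hSG
  have habove : ∀ x ∈ B, ∃ m ∈ S, m ⤳ x := by
    intro x hx
    have hfin : {g ∈ G | g ⤳ x}.Finite := hGf.subset fun g hg => hg.1
    obtain ⟨m, hm, hmm⟩ := hfin.exists_maximalFor (fun g => closure {g}) _ (hG x hx)
    refine ⟨m, ⟨hGB hm.1, fun z hz hzm => ?_⟩, hm.2⟩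
    obtain ⟨g, hg, hgz⟩ := hG z hz
    have h1 : g ⤳ m := hgz.trans hzm
    have h2 : closure {g} ≤ closure {m} :=
      hmm (j := g) ⟨hg, h1.trans hm.2⟩ (specializes_iff_closure_subset.1 h1)
    have h3 : m ⤳ g := specializes_iff_closure_subset.2 h2
    have h4 : m ⤳ z := h3.trans hgz
    exact (hzm.antisymm h4).eq
  have hlift : ∀ y : S, ∃ m : S, φ m = y := by
    intro y
    obtain ⟨x, hx⟩ := hs y
    have hxB : x ∈ B := h (by rw [Set.mem_preimage, hx]; exact y.2.1)
    obtain ⟨m, hm, hmx⟩ := habove x hxB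
    refine ⟨⟨m, hm⟩, y.2.2 _ ?_ ?_⟩
    · have := hm.1
      rw [← heq] at this
      exact this
    · rw [← hx]; exact hmx.map hφ
  choose ψ hψ using hlift
  haveI := hSf.to_subtype
  have hinj : Function.Injective ψ := fun a b hab => Subtype.ext (by rw [← hψ a, ← hψ b, hab])
  obtain ⟨r, hr, hper⟩ := hinj.mem_periodicPts ⟨y, hy, hmax⟩
  refine ⟨r, hr, ?_⟩
  have key : ∀ (n : ℕ) (z : S), φ^[n] (ψ^[n] z) = z := by
    intro n
    induction n with
    | zero => intro z; rfl
    | succ n ih =>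
      intro z
      rw [Function.iterate_succ_apply' ψ, Function.iterate_succ_apply φ, hψ, ih]
  have := key r ⟨y, hy, hmax⟩
  rwa [hper.eq] at this
end

section
open TopologicalSpace IsLocalRing

variable {k K : Type*} [Field k] [Field K] [Algebra k K]

/-- The `m`-th power of the maximal ideal of a local subring of `K`, as a subset of `K`. -/
def maxPow (O : Subalgebra k K) [IsLocalRing O] (m : ℕ) : Set K :=
  Subtype.val '' ((maximalIdeal O ^ m : Ideal O) : Set O)

lemma maxPow_zero (O : Subalgebra k K) [IsLocalRing O] : maxPow O 0 = O := by
  ext x; simp [maxPow]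

lemma mem_maxPow_one {O : Subalgebra k K} [IsLocalRing O] {a : K} :
    a ∈ maxPow O 1 ↔ a ∈ O ∧ (a = 0 ∨ a⁻¹ ∉ O) := by
  constructor
  · rintro ⟨⟨a, ha⟩, h, rfl⟩
    refine ⟨ha, ?_⟩
    by_contra! hc
    rw [pow_one] at h
    have : IsUnit (⟨a, ha⟩ : O) :=
      IsUnit.of_mul_eq_one ⟨a⁻¹, hc.2⟩ (Subtype.ext (mul_inv_cancel₀ hc.1))
    exact h this
  · rintro ⟨ha, h⟩
    refine ⟨⟨a, ha⟩, ?_, rfl⟩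
    rw [pow_one]
    intro hu
    obtain ⟨b, hb⟩ := hu.exists_right_inv
    have hb' : a * b = 1 := congrArg Subtype.val hb
    rcases h with rfl | h
    · simp at hb'
    · exact h (by rw [inv_eq_of_mul_eq_one_right hb']; exact b.2)

lemma mul_mem_maxPow {O : Subalgebra k K} [IsLocalRing O] {m n : ℕ} {a b : K}
    (ha : a ∈ maxPow O m) (hb : b ∈ maxPow O n) : a * b ∈ maxPow O (m + n) := by
  obtain ⟨a, ha, rfl⟩ := ha
  obtain ⟨b, hb, rfl⟩ := hb
  refine ⟨a * b, ?_, rfl⟩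
  rw [pow_add]
  exact Ideal.mul_mem_mul ha hb

lemma eq_zero_of_mem_maxPow {O : Subalgebra k K} [IsLocalRing O] [IsNoetherianRing O] {a : K}
    (h : ∀ m, a ∈ maxPow O m) : a = 0 := by
  have haO : a ∈ O := by have := h 0; rwa [maxPow_zero] at this
  have : (⟨a, haO⟩ : O) ∈ ⨅ i : ℕ, maximalIdeal O ^ i := by
    rw [Ideal.mem_iInf]
    intro m
    obtain ⟨b, hb, hba⟩ := h m
    have : b = ⟨a, haO⟩ := Subtype.ext hba
    rwa [← this]
  rw [Ideal.iInf_pow_eq_bot_of_isLocalRing _ (maximalIdeal.isMaximal O).ne_top] at this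
  exact congrArg Subtype.val this

lemma map_mem_maxPow {O O' : Subalgebra k K} [IsLocalRing O] [IsLocalRing O'] (E : K →ₐ[k] K)
    (hE : ∀ f ∈ O, E f ∈ O') (hE' : ∀ f ∈ O, (E f)⁻¹ ∈ O' → f⁻¹ ∈ O) {m : ℕ} {a : K}
    (ha : a ∈ maxPow O m) : E a ∈ maxPow O' m := by
  obtain ⟨a, ha, rfl⟩ := ha
  let ε : O →+* O' := ((E.comp O.val).codRestrict O' fun x => hE x x.2 : O →ₐ[k] O')
  have hm : maximalIdeal O ≤ (maximalIdeal O').comap ε := by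
    intro x hx
    have h1 : (x : K) ∈ maxPow O 1 := ⟨x, by rwa [pow_one], rfl⟩
    rw [mem_maxPow_one] at h1
    have h2 : E x ∈ maxPow O' 1 := by
      rw [mem_maxPow_one]
      refine ⟨hE _ x.2, ?_⟩
      rcases h1.2 with h | h
      · left; rw [h, map_zero]
      · right; exact fun h' => h (hE' _ x.2 h')
    obtain ⟨y, hy, hyx⟩ := h2
    have : y = ε x := Subtype.ext hyx
    rw [Ideal.mem_comap, ← this]
    rwa [pow_one] at hy
  have h3 := (Ideal.pow_right_mono hm m).trans (Ideal.le_comap_pow ε m)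
  exact ⟨ε a, h3 ha, rfl⟩

/-- Sections of the `n`-th power of the invertible sheaf with local generators `δ`. -/
def secW {X : Type*} (O : X → Subalgebra k K) (δ : X → K) (n : ℕ) : Submodule k K where
  carrier := {f | ∀ x, f / δ x ^ n ∈ O x}
  add_mem' := fun hf hg x => by rw [add_div]; exact (O x).add_mem (hf x) (hg x)
  zero_mem' := fun x => by simp
  smul_mem' := fun c f hf x => by
    rw [Algebra.smul_def, mul_div_assoc]
    exact (O x).mul_mem ((O x).algebraMap_mem c) (hf x)

theorem ramification_core {X : Type*} [TopologicalSpace X] [NoetherianSpace X] [QuasiSober X]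
    [T0Space X] (O : X → Subalgebra k K) [∀ x, IsLocalRing (O x)] [∀ x, IsNoetherianRing (O x)]
    (hop : ∀ f : K, IsOpen {x | f ∈ O x})
    (δ : X → K) (hδ : ∀ x, δ x ≠ 0)
    (hloc : ∀ x, ∃ U : Set X, IsOpen U ∧ x ∈ U ∧ ∀ x' ∈ U, δ x' / δ x ∈ O x' ∧ δ x / δ x' ∈ O x')
    (n : ℕ) (hn : 0 < n) [Module.Finite k (secW O δ n)] (f₀ : K) (hf₀ : f₀ ∈ secW O δ n)
    (hf₀0 : f₀ ≠ 0)
    (φ : X → X) (hφ : Continuous φ) (hφs : Function.Surjective φ) (E : K →ₐ[k] K)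
    (hE : ∀ x, ∀ f ∈ O (φ x), E f ∈ O x)
    (hE' : ∀ x, ∀ f ∈ O (φ x), (E f)⁻¹ ∈ O x → f⁻¹ ∈ O (φ x))
    (J : K) (hJ : J ≠ 0) (hj : ∀ x, E (δ (φ x)) * J / δ x ∈ O x)
    (hkrull : ∀ x, ∀ a ∈ maxPow (O x) 1, a ≠ 0 → ∃ y, y ⤳ x ∧ a ∈ maxPow (O y) 1 ∧
      ∀ z, z ⤳ y → z = y ∨ O z = ⊤) :
    ∀ x, (E (δ (φ x)) * J / δ x)⁻¹ ∈ O x := by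
  set W := secW O δ n with hW
  have hEinj : Function.Injective E := E.toRingHom.injective
  -- the pullback of sections
  have hpull : ∀ f x, E f * J ^ n / δ x ^ n =
      E (f / δ (φ x) ^ n) * (E (δ (φ x)) * J / δ x) ^ n := by
    intro f x
    have h1 : E (δ (φ x)) ≠ 0 := by
      rw [Ne, map_eq_zero_iff E hEinj]; exact hδ _
    rw [map_div₀, map_pow, div_pow, mul_pow]
    field_simp
  let T : W →ₗ[k] W :=
    { toFun := fun f => ⟨E f * J ^ n, fun x => by
        rw [hpull]
        exact (O x).mul_mem (hE x _ (f.2 (φ x))) ((O x).pow_mem (hj x) n)⟩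
      map_add' := fun f g => by ext; simp [add_mul]
      map_smul' := fun c f => by ext; simp }
  have hTinj : Function.Injective T := by
    intro f g h
    have h1 : E f * J ^ n = E g * J ^ n := congrArg Subtype.val h
    exact Subtype.ext (hEinj (mul_right_cancel₀ (pow_ne_zero n hJ) h1))
  have hTsurj : Function.Surjective T := LinearMap.injective_iff_surjective.1 hTinj
  have hWT : ∀ f ∈ W, ∃ g ∈ W, f = E g * J ^ n := by
    intro f hf
    obtain ⟨g, hg⟩ := hTsurj ⟨f, hf⟩
    exact ⟨g, g.2, (congrArg Subtype.val hg).symm⟩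
  let B : Set X := {x | ∀ f ∈ W, f / δ x ^ n ∈ maxPow (O x) 1}
  have hunit : ∀ {x : X} {a b : K}, a⁻¹ ∈ O x → a ≠ 0 → a * b ∈ maxPow (O x) 1 →
      b ∈ maxPow (O x) 1 := by
    intro x a b ha ha0 hab
    have h0 : a⁻¹ ∈ maxPow (O x) 0 := by rw [maxPow_zero]; exact ha
    have := mul_mem_maxPow h0 hab
    rwa [zero_add, inv_mul_cancel_left₀ ha0] at this
  have hBclosed : IsClosed B := by
    rw [← isOpen_compl_iff, isOpen_iff_mem_nhds]
    intro x hx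
    simp only [B, Set.mem_compl_iff, Set.mem_setOf_eq, not_forall] at hx
    obtain ⟨f, hf, hfx⟩ := hx
    rw [mem_maxPow_one] at hfx
    push Not at hfx
    obtain ⟨hf0, hfi⟩ := hfx (hf x)
    obtain ⟨U, hU, hxU, hUl⟩ := hloc x
    filter_upwards [hU.mem_nhds hxU, (hop _).mem_nhds hfi] with y hyU hyi hyB
    have := hyB f hf
    rw [mem_maxPow_one] at this
    rcases this.2 with h | h
    · rcases div_eq_zero_iff.1 h with h | h
      · exact hf0 (by rw [h, zero_div])
      · exact pow_ne_zero n (hδ y) h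
    · apply h
      have e : (f / δ y ^ n)⁻¹ = (f / δ x ^ n)⁻¹ * (δ y / δ x) ^ n := by
        have := hδ x
        rw [inv_div, inv_div, div_pow]
        have hfne : f ≠ 0 := by rintro rfl; exact hf0 (zero_div _)
        field_simp
      rw [e]
      exact (O y).mul_mem hyi ((O y).pow_mem (hUl y hyU).1 n)
  have hBtop : ∀ z, O z = ⊤ → z ∉ B := by
    intro z hz hzB
    have := hzB f₀ hf₀
    rw [mem_maxPow_one, hz] at this
    rcases this.2 with h | h
    · exact div_ne_zero hf₀0 (pow_ne_zero n (hδ z)) h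
    · exact h Algebra.mem_top
  have hBpre : φ ⁻¹' B ⊆ B := by
    intro x hx f hf
    obtain ⟨g, hg, rfl⟩ := hWT f hf
    rw [hpull]
    have h1 := map_mem_maxPow E (hE x) (hE' x) (hx g hg)
    have h2 : (E (δ (φ x)) * J / δ x) ^ n ∈ maxPow (O x) 0 := by
      rw [maxPow_zero]; exact (O x).pow_mem (hj x) n
    exact mul_mem_maxPow h1 h2
  have hjne : ∀ x, E (δ (φ x)) * J / δ x ≠ 0 := by
    intro x
    refine div_ne_zero (mul_ne_zero ?_ hJ) (hδ x)
    rw [Ne, map_eq_zero_iff E hEinj]; exact hδ _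
  have hQ : ∀ z m, (∀ f ∈ W, f / δ (φ z) ^ n ∈ maxPow (O (φ z)) m) →
      ∀ f ∈ W, f / δ z ^ n ∈ maxPow (O z) m := by
    intro z m h f hf
    obtain ⟨g, hg, rfl⟩ := hWT f hf
    rw [hpull]
    have h1 := map_mem_maxPow E (hE z) (hE' z) (h g hg)
    have h2 : (E (δ (φ z)) * J / δ z) ^ n ∈ maxPow (O z) 0 := by
      rw [maxPow_zero]; exact (O z).pow_mem (hj z) n
    exact mul_mem_maxPow h1 h2
  have hQ' : ∀ z m, E (δ (φ z)) * J / δ z ∈ maxPow (O z) 1 →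
      (∀ f ∈ W, f / δ (φ z) ^ n ∈ maxPow (O (φ z)) m) →
      ∀ f ∈ W, f / δ z ^ n ∈ maxPow (O z) (m + 1) := by
    intro z m hz h f hf
    obtain ⟨g, hg, rfl⟩ := hWT f hf
    rw [hpull]
    have h1 := map_mem_maxPow E (hE z) (hE' z) (h g hg)
    have h2 : (E (δ (φ z)) * J / δ z) ^ n ∈ maxPow (O z) 1 := by
      obtain ⟨n, rfl⟩ := Nat.exists_eq_succ_of_ne_zero hn.ne'
      rw [Nat.succ_eq_add_one, pow_succ']
      have h3 : (E (δ (φ z)) * J / δ z) ^ n ∈ maxPow (O z) 0 := by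
        rw [maxPow_zero]; exact (O z).pow_mem (hj z) n
      exact mul_mem_maxPow hz h3
    exact mul_mem_maxPow h1 h2
  intro x
  by_contra hx
  obtain ⟨y, hyx, hy, hymin⟩ := hkrull x _ (mem_maxPow_one.2 ⟨hj x, Or.inr hx⟩) (hjne x)
  have hjy : E (δ (φ y)) * J / δ y ∈ maxPow (O y) 1 := by
    obtain ⟨U, hU, hxU, hUl⟩ := hloc x
    obtain ⟨U', hU', hxU', hUl'⟩ := hloc (φ x)
    have hyU := hUl y (hyx.mem_open hU hxU)
    have hyU' := hUl' (φ y) ((hyx.map hφ).mem_open hU' hxU')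
    have h0 : E (δ (φ y) / δ (φ x)) * (δ x / δ y) ∈ maxPow (O y) 0 := by
      rw [maxPow_zero]
      exact (O y).mul_mem (hE y _ hyU'.1) hyU.2
    have := mul_mem_maxPow h0 hy
    rw [zero_add] at this
    convert this using 1
    have h1 : E (δ (φ x)) ≠ 0 := by
      rw [Ne, map_eq_zero_iff E hEinj]; exact hδ _
    have h2 := hδ x
    have h3 := hδ y
    rw [map_div₀]
    field_simp
  have hyB : y ∈ B := fun f hf => by
    have := hQ' y 0 hjy (fun f hf => by rw [maxPow_zero]; exact hf _) f hf
    exact this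
  obtain ⟨r, hr, hper⟩ := exists_periodic_of_maximal hφ hφs hBclosed hBpre hyB
    (fun z hz hzy => (hymin z hzy).resolve_right fun h => hBtop z h hz)
  have hiter : ∀ m s, (∀ f ∈ W, f / δ (φ^[s] (φ y)) ^ n ∈ maxPow (O (φ^[s] (φ y))) m) →
      ∀ f ∈ W, f / δ (φ y) ^ n ∈ maxPow (O (φ y)) m := by
    intro m s
    induction s with
    | zero => exact fun h => h
    | succ s ih =>
      intro h
      apply ih
      apply hQ
      rwa [Function.iterate_succ_apply'] at h
  have hall : ∀ m, ∀ f ∈ W, f / δ y ^ n ∈ maxPow (O y) m := by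
    intro m
    induction m with
    | zero => intro f hf; rw [maxPow_zero]; exact hf y
    | succ m ih =>
      apply hQ' y m hjy
      apply hiter m (r - 1)
      rw [← Function.iterate_succ_apply, Nat.succ_eq_add_one, Nat.sub_add_cancel hr, hper]
      exact ih
  exact div_ne_zero hf₀0 (pow_ne_zero n (hδ y)) (eq_zero_of_mem_maxPow fun m => hall m f₀ hf₀)
end

section Differentials

open KaehlerDifferential TensorProduct

lemma D_mem_of_mem_adjoin {k F : Type*} [Field k] [Field F] [Algebra k F] {s : Set F}
    (N : Submodule F Ω[F⁄k]) (hs : ∀ a ∈ s, D k F a ∈ N) {a : F}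
    (ha : a ∈ IntermediateField.adjoin k s) : D k F a ∈ N := by
  induction ha using IntermediateField.adjoin_induction with
  | mem x hx => exact hs x hx
  | algebraMap x => simp
  | add x y _ _ hx hy => rw [map_add]; exact add_mem hx hy
  | inv x _ hx => rw [Derivation.leibniz_inv]; exact N.smul_mem _ hx
  | mul x y _ _ hx hy =>
    rw [Derivation.leibniz]; exact add_mem (N.smul_mem _ hy) (N.smul_mem _ hx)

lemma span_D_eq_top_of_isSeparable {k F : Type*} [Field k] [Field F] [Algebra k F] (s : Set F)
    [Algebra.IsSeparable (IntermediateField.adjoin k s) F] :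
    Submodule.span F (D k F '' s) = ⊤ := by
  haveI : Algebra.FormallyEtale (IntermediateField.adjoin k s) F :=
    Algebra.FormallyEtale.of_isSeparable _ _
  rw [eq_top_iff]
  rintro w -
  have hw := (exact_mapBaseChange_map k (IntermediateField.adjoin k s) F w).1
    (Subsingleton.elim _ _)
  obtain ⟨t, rfl⟩ := hw
  induction t with
  | zero => simp
  | add x y hx hy => rw [map_add]; exact add_mem hx hy
  | tmul x y =>
    rw [mapBaseChange_tmul]
    refine Submodule.smul_mem _ _ ?_
    have hy : y ∈ Submodule.span (IntermediateField.adjoin k s)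
      (Set.range (D k (IntermediateField.adjoin k s))) := by
      rw [span_range_derivation]; trivial
    induction hy using Submodule.span_induction with
    | zero => simp
    | add a b _ _ ha hb => rw [map_add]; exact add_mem ha hb
    | smul c a _ ha =>
      rw [map_smul]
      exact (Submodule.span F (D k F '' s)).smul_mem (c : F) ha
    | mem a ha =>
      obtain ⟨b, rfl⟩ := ha
      rw [map_D]
      exact D_mem_of_mem_adjoin _ (fun a ha => Submodule.subset_span (Set.mem_image_of_mem _ ha)) b.2

/-- Over a perfect field, elements with linearly independent differentials are algebraically
independent. -/
lemma algebraicIndependent_of_linearIndependent_D {k F : Type*} [Field k] [PerfectField k]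
    [Field F] [Algebra k F] {g : ℕ} (a : Fin g → F)
    (ha : LinearIndependent F fun i => D k F (a i)) : AlgebraicIndependent k a := by
  classical
  let L : IntermediateField k F := IntermediateField.adjoin k (Set.range a)
  have hfg : L.FG := ⟨(Set.finite_range a).toFinset, by
    rw [Set.Finite.coe_toFinset]⟩
  haveI : Algebra.EssFiniteType k L := IntermediateField.essFiniteType_iff.2 hfg
  obtain ⟨s, hs, hsep⟩ := exists_isTranscendenceBasis_and_isSeparable_of_perfectField k L
  have htop := span_D_eq_top_of_isSeparable (k := k) (s : Set L)
  let a' : Fin g → L := fun i => ⟨a i, IntermediateField.subset_adjoin _ _ ⟨i, rfl⟩⟩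
  have hcard : g ≤ s.card := by
    have hmem : ∀ i, D k F (a i) ∈ Submodule.span F
        (((s.image fun x : L => D k F (x : F)) : Finset Ω[F⁄k]) : Set Ω[F⁄k]) := by
      intro i
      have h1 : D k L (a' i) ∈ Submodule.span L (D k L '' (s : Set L)) := by
        rw [htop]; trivial
      have h2 : map k k L F (D k L (a' i)) = D k F (a i) := by rw [map_D]; rfl
      rw [← h2]
      generalize D k L (a' i) = w at h1
      induction h1 using Submodule.span_induction with
      | zero => simp
      | add a b _ _ ha hb => rw [map_add]; exact add_mem ha hb
      | smul c a _ ha =>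
        rw [map_smul]
        exact (Submodule.span F _).smul_mem (c : F) ha
      | mem a ha =>
        obtain ⟨b, hb, rfl⟩ := ha
        rw [map_D]
        refine Submodule.subset_span ?_
        simp only [Finset.coe_image]
        exact ⟨b, hb, rfl⟩
    have h3 : LinearIndependent F
        (fun i => (⟨D k F (a i), hmem i⟩ : Submodule.span F
        (((s.image fun x : L => D k F (x : F)) : Finset Ω[F⁄k]) : Set Ω[F⁄k]))) := by
      exact LinearIndependent.of_comp (Submodule.subtype _) ha
    have h4 := h3.fintype_card_le_finrank
    rw [Fintype.card_fin] at h4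
    exact h4.trans ((finrank_span_finset_le_card _).trans Finset.card_image_le)
  have htr : IsTranscendenceBasis k a' := by
    haveI : Algebra.IsAlgebraic (Algebra.adjoin k (Set.range a')) L := by
      have hal : IntermediateField.adjoin k (Set.range a') = ⊤ := by
        apply IntermediateField.map_injective L.val
        rw [IntermediateField.adjoin_map, ← AlgHom.fieldRange_eq_map, IntermediateField.fieldRange_val]
        congr 1
        ext x; simp [a']
      rw [← IntermediateField.isAlgebraic_adjoin_iff_top, hal, Algebra.isAlgebraic_iff_isIntegral]
      exact Algebra.isIntegral_of_surjective IntermediateField.topEquiv.surjective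
    refine Algebra.IsAlgebraic.isTranscendenceBasis_of_lift_le_trdeg_of_finite k a' ?_
    rw [← hs.cardinalMk_eq_trdeg]
    simpa using hcard
  exact htr.1.map' (f := L.val) L.val.injective

end Differentials

section Differentials

open KaehlerDifferential TensorProduct

lemma exists_algebraicIndependent_of_basis_differentials {k R K : Type*} [Field k] [PerfectField k]
    [CommRing R] [IsDomain R] [Field K] [Algebra k R] [Algebra R K] [Algebra k K]
    [IsScalarTower k R K]
    [IsFractionRing R K] {g : ℕ} (b : Module.Basis (Fin g) R Ω[R⁄k]) :
    ∃ a : Fin g → R, AlgebraicIndependent k a := by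
  let b' : Module.Basis (Fin g) K Ω[K⁄k] :=
    b.ofIsLocalizedModule K (nonZeroDivisors R) (map k k R K)
  have hspan := span_range_map_derivation_of_isLocalization k R K (nonZeroDivisors R)
  obtain ⟨t, ht, hst, hli⟩ := exists_linearIndependent K (Set.range (map k k R K ∘ D k R))
  rw [hspan] at hst
  let c : Module.Basis t K Ω[K⁄k] := Module.Basis.mk hli (by rw [Subtype.range_coe]; exact hst.ge)
  let σ : Fin g ≃ t := b'.indexEquiv c
  choose a ha using fun i => ht (σ i).2
  refine ⟨a, ?_⟩
  rw [← AlgHom.algebraicIndependent_iff (IsScalarTower.toAlgHom k R K) (IsFractionRing.injective R K)]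
  refine algebraicIndependent_of_linearIndependent_D _ ?_
  have : (fun i => D k K ((⇑(IsScalarTower.toAlgHom k R K) ∘ a) i)) =
      (fun x : t => (x : Ω[K⁄k])) ∘ σ := by
    funext i
    simp only [Function.comp_apply, IsScalarTower.coe_toAlgHom']
    rw [← ha i, Function.comp_apply, map_D]
  rw [this]
  exact hli.comp _ σ.injective

lemma isFractionRing_of_basis_differentials {k R K : Type*} [Field k] [PerfectField k] [CommRing R]
    [Field K] [Algebra k R] [Algebra R K] [Algebra k K] [IsScalarTower k R K]
    (hinj : Function.Injective (algebraMap R K)) {g : ℕ} (b : Module.Basis (Fin g) R Ω[R⁄k])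
    (htr : Algebra.trdeg k K ≤ g)
    (hintegral : ∀ y : K, IsIntegral R y → y ∈ Set.range (algebraMap R K)) : IsFractionRing R K := by
  haveI : IsDomain R := hinj.isDomain
  obtain ⟨a, ha⟩ := exists_algebraicIndependent_of_basis_differentials (K := FractionRing R) b
  have ha' : AlgebraicIndependent k (IsScalarTower.toAlgHom k R K ∘ a) :=
    (AlgHom.algebraicIndependent_iff (IsScalarTower.toAlgHom k R K) hinj).2 ha
  have hB := ha'.isTranscendenceBasis_of_lift_trdeg_le_of_finite (by simpa using htr)
  have halg := hB.isAlgebraic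
  have hle : Algebra.adjoin k (Set.range (IsScalarTower.toAlgHom k R K ∘ a)) ≤
      (IsScalarTower.toAlgHom k R K).range := by
    rw [Algebra.adjoin_le_iff]
    rintro _ ⟨i, rfl⟩
    exact ⟨a i, rfl⟩
  let e := AlgEquiv.ofInjective (IsScalarTower.toAlgHom k R K) hinj
  have key : ∀ y : K, ∃ r s : R, s ≠ 0 ∧ algebraMap R K s * y = algebraMap R K r := by
    intro y
    have hy : IsAlgebraic R y :=
      (halg.isAlgebraic y).ringHom_of_comp_eq
        (e.symm.toAlgHom.comp (Subalgebra.inclusion hle)) (RingHom.id K)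
        (e.symm.injective.comp (Subalgebra.inclusion_injective hle)) (by
          ext z
          have := e.apply_symm_apply (Subalgebra.inclusion hle z)
          exact congrArg Subtype.val this)
    obtain ⟨s, hs, hsy⟩ := hy.exists_integral_multiple
    obtain ⟨r, hr⟩ := hintegral _ hsy
    exact ⟨r, s, hs, by rw [hr, Algebra.smul_def]⟩
  haveI : FaithfulSMul R K := (faithfulSMul_iff_algebraMap_injective R K).2 hinj
  refine IsFractionRing.of_field R K fun z => ?_
  obtain ⟨r, s, hs, h⟩ := key z
  refine ⟨r, s, ?_⟩
  have hs' : algebraMap R K s ≠ 0 := (map_ne_zero_iff _ hinj).2 hs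
  field_simp
  linear_combination h

end Differentials

section IsDet

open KaehlerDifferential TensorProduct

variable {k K : Type*} [Field k] [Field K] [Algebra k K] {g : ℕ}

/-- The lattice of differentials of a subalgebra inside the differentials of the ambient field. -/
def diffLattice (O : Subalgebra k K) : Submodule O Ω[K⁄k] :=
  Submodule.span O (Set.range fun a : O => D k K (a : K))

lemma D_mem_diffLattice (O : Subalgebra k K) {a : K} (ha : a ∈ O) : D k K a ∈ diffLattice O :=
  Submodule.subset_span ⟨⟨a, ha⟩, rfl⟩

/-- `e` is a basis of the lattice of differentials of `O`. -/
def IsDiffBasis (O : Subalgebra k K) (e : Module.Basis (Fin g) K Ω[K⁄k]) : Prop :=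
  Submodule.span O (Set.range e) = diffLattice O

/-- `δ` is the coordinate of a generator of the top exterior power of the lattice of
differentials of `O`. -/
def IsDet (θ : Module.Basis (Fin g) K Ω[K⁄k]) (O : Subalgebra k K) (δ : K) : Prop :=
  ∃ e : Module.Basis (Fin g) K Ω[K⁄k], IsDiffBasis O e ∧ θ.det e = δ

lemma IsDet.ne_zero {θ : Module.Basis (Fin g) K Ω[K⁄k]} {O : Subalgebra k K} {δ : K}
    (h : IsDet θ O δ) : δ ≠ 0 := by
  obtain ⟨e, -, rfl⟩ := h
  exact (θ.isUnit_det e).ne_zero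

lemma repr_mem_of_mem_span {O : Subalgebra k K} (e : Module.Basis (Fin g) K Ω[K⁄k])
    {v : Ω[K⁄k]} (hv : v ∈ Submodule.span O (Set.range e)) (j : Fin g) : e.repr v j ∈ O := by
  induction hv using Submodule.span_induction with
  | zero => simp
  | add a b _ _ ha hb => rw [map_add]; exact add_mem ha hb
  | smul c a _ ha =>
    have : e.repr (c • a) = (c : K) • e.repr a := by
      rw [← map_smul]; rfl
    rw [this]
    exact mul_mem c.2 ha
  | mem a ha =>
    obtain ⟨i, rfl⟩ := ha
    rw [e.repr_self, Finsupp.single_apply]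
    split_ifs
    exacts [one_mem _, zero_mem _]

lemma det_mem_of_entries {O : Subalgebra k K} {M : Matrix (Fin g) (Fin g) K}
    (h : ∀ i j, M i j ∈ O) : M.det ∈ O := by
  have : M = (Matrix.of fun i j => (⟨M i j, h i j⟩ : O)).map (algebraMap O K) := by
    ext i j; rfl
  rw [this, ← RingHom.mapMatrix_apply, ← RingHom.map_det]
  exact SetLike.coe_mem _

lemma IsDet.det_div_mem {θ : Module.Basis (Fin g) K Ω[K⁄k]} {O : Subalgebra k K} {δ : K}
    (h : IsDet θ O δ) {v : Fin g → Ω[K⁄k]} (hv : ∀ i, v i ∈ diffLattice O) :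
    θ.det v / δ ∈ O := by
  have h0 := h.ne_zero
  obtain ⟨e, he, rfl⟩ := h
  have h1 : θ.det v = θ.det e * (e.toMatrix v).det := by
    rw [Module.Basis.det_apply, Module.Basis.det_apply, ← Matrix.det_mul,
      Module.Basis.toMatrix_mul_toMatrix]
  rw [h1, mul_div_cancel_left₀ _ h0]
  refine det_mem_of_entries fun i j => ?_
  rw [Module.Basis.toMatrix_apply]
  exact repr_mem_of_mem_span e (he ▸ hv j) i

lemma IsDiffBasis.mem {O : Subalgebra k K} {e : Module.Basis (Fin g) K Ω[K⁄k]}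
    (h : IsDiffBasis O e) (i : Fin g) : e i ∈ diffLattice O := by
  rw [← h]; exact Submodule.subset_span ⟨i, rfl⟩

lemma IsDet.div_mem {θ : Module.Basis (Fin g) K Ω[K⁄k]} {O : Subalgebra k K} {δ δ' : K}
    (h : IsDet θ O δ) (h' : IsDet θ O δ') : δ' / δ ∈ O := by
  obtain ⟨e, he, rfl⟩ := h'
  exact h.det_div_mem he.mem

lemma diffLattice_mono {O O' : Subalgebra k K} (h : O ≤ O') {v : Ω[K⁄k]}
    (hv : v ∈ diffLattice O) : v ∈ diffLattice O' := by
  induction hv using Submodule.span_induction with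
  | zero => exact zero_mem _
  | add a b _ _ ha hb => exact add_mem ha hb
  | smul c a _ ha => exact (diffLattice O').smul_mem ⟨c, h c.2⟩ ha
  | mem a ha =>
    obtain ⟨i, rfl⟩ := ha
    exact D_mem_diffLattice _ (h i.2)

lemma IsDiffBasis.of_localization {O O' : Subalgebra k K} (h : O ≤ O')
    (hloc : ∀ f ∈ O', ∃ a ∈ O, ∃ s ∈ O, s⁻¹ ∈ O' ∧ f = a / s)
    {e : Module.Basis (Fin g) K Ω[K⁄k]} (he : IsDiffBasis O e) : IsDiffBasis O' e := by
  have hD : ∀ a ∈ O, D k K a ∈ Submodule.span O' (Set.range e) := by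
    intro a ha
    have := D_mem_diffLattice O ha
    rw [← he] at this
    generalize D k K a = v at this
    induction this using Submodule.span_induction with
    | zero => exact zero_mem _
    | add a b _ _ ha hb => exact add_mem ha hb
    | smul c a _ ha => exact Submodule.smul_mem _ (⟨c, h c.2⟩ : O') ha
    | mem a ha => exact Submodule.subset_span ha
  apply le_antisymm
  · rw [Submodule.span_le]
    rintro _ ⟨i, rfl⟩
    exact diffLattice_mono h (he.mem i)
  · rw [diffLattice, Submodule.span_le]
    rintro _ ⟨⟨f, hf⟩, rfl⟩
    obtain ⟨a, ha, s, hs, hs', rfl⟩ := hloc f hf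
    have h1 : D k K (a / s) = (⟨s⁻¹, hs'⟩ : O') • D k K a
        - ((⟨a, h ha⟩ : O') * ⟨s⁻¹, hs'⟩ * ⟨s⁻¹, hs'⟩) • D k K s := by
      change _ = s⁻¹ • D k K a - (a * s⁻¹ * s⁻¹) • D k K s
      rw [div_eq_mul_inv, Derivation.leibniz, Derivation.leibniz_inv, smul_smul]
      rw [add_comm, sub_eq_add_neg, ← neg_smul]
      congr 2
      ring
    change D k K (a / s) ∈ _
    rw [h1]
    exact sub_mem (Submodule.smul_mem _ _ (hD _ ha)) (Submodule.smul_mem _ _ (hD _ hs))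

/-- A basis of the differentials of a ring with fraction field `K` gives a basis of the lattice
of differentials of its image in `K`. -/
lemma exists_isDiffBasis_of_basis {R : Type*} [CommRing R] [Algebra k R] [Algebra R K]
    [IsScalarTower k R K] [IsFractionRing R K] [IsDomain R] (b : Module.Basis (Fin g) R Ω[R⁄k]) :
    ∃ e : Module.Basis (Fin g) K Ω[K⁄k],
      (∀ i, e i = map k k R K (b i)) ∧ IsDiffBasis (IsScalarTower.toAlgHom k R K).range e := by
  let e : Module.Basis (Fin g) K Ω[K⁄k] :=
    b.ofIsLocalizedModule K (nonZeroDivisors R) (map k k R K)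
  have he : ∀ i, e i = map k k R K (b i) := fun i =>
    b.ofIsLocalizedModule_apply K (nonZeroDivisors R) (map k k R K) i
  have hsm : ∀ (r : R) (v : Ω[K⁄k]),
      r • v = (⟨algebraMap R K r, ⟨r, rfl⟩⟩ : (IsScalarTower.toAlgHom k R K).range) • v := by
    intro r v
    exact algebra_compatible_smul K r v
  have h1 : ∀ w : Ω[R⁄k], map k k R K w ∈
      Submodule.span (IsScalarTower.toAlgHom k R K).range (Set.range e) := by
    intro w
    rw [← b.sum_repr w, map_sum]
    refine sum_mem fun i _ => ?_
    rw [map_smul, hsm]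
    exact Submodule.smul_mem _ _ (Submodule.subset_span ⟨i, he i⟩)
  have h2 : ∀ w : Ω[R⁄k], map k k R K w ∈ diffLattice (IsScalarTower.toAlgHom k R K).range := by
    intro w
    have hw : w ∈ Submodule.span R (Set.range (D k R)) := by
      rw [span_range_derivation]; trivial
    induction hw using Submodule.span_induction with
    | zero => simp
    | add a b _ _ ha hb => rw [map_add]; exact add_mem ha hb
    | smul c a _ ha => rw [map_smul, hsm]; exact Submodule.smul_mem _ _ ha
    | mem a ha =>
      obtain ⟨i, rfl⟩ := ha
      rw [map_D]
      exact D_mem_diffLattice _ ⟨i, rfl⟩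
  refine ⟨e, he, le_antisymm ?_ ?_⟩
  · rw [Submodule.span_le]
    rintro _ ⟨i, rfl⟩
    rw [he]; exact h2 _
  · rw [diffLattice, Submodule.span_le]
    rintro _ ⟨⟨_, r, rfl⟩, rfl⟩
    have := h1 (D k R r)
    rwa [map_D] at this

end IsDet

section Pull

open KaehlerDifferential TensorProduct

lemma exists_pull_differentials {k K₁ K₂ : Type*} [Field k] [Field K₁] [Field K₂]
    [Algebra k K₁] [Algebra k K₂] (ε : K₁ →ₐ[k] K₂)
    (hε : @Algebra.IsSeparable K₁ K₂ _ _ ε.toRingHom.toAlgebra)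
    {g : ℕ} (θ₁ : Module.Basis (Fin g) K₁ Ω[K₁⁄k]) (θ₂ : Module.Basis (Fin g) K₂ Ω[K₂⁄k]) :
    ∃ P : Ω[K₁⁄k] →+ Ω[K₂⁄k], (∀ c w, P (c • w) = ε c • P w) ∧
      (∀ a, P (D k K₁ a) = D k K₂ (ε a)) ∧ θ₂.det (fun i => P (θ₁ i)) ≠ 0 ∧
      ∀ v : Fin g → Ω[K₁⁄k], θ₂.det (fun i => P (v i)) =
        ε (θ₁.det v) * θ₂.det (fun i => P (θ₁ i)) := by
  letI : Algebra K₁ K₂ := ε.toRingHom.toAlgebra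
  haveI : IsScalarTower k K₁ K₂ := IsScalarTower.of_algebraMap_eq fun c => (ε.commutes c).symm
  haveI : Algebra.IsSeparable K₁ K₂ := hε
  haveI : Algebra.FormallyEtale K₁ K₂ := Algebra.FormallyEtale.of_isSeparable _ _
  have hsm : ∀ (c : K₁) (w : Ω[K₁⁄k]), map k k K₁ K₂ (c • w) = ε c • map k k K₁ K₂ w := by
    intro c w
    rw [map_smul]
    exact algebra_compatible_smul K₂ c _
  refine ⟨(map k k K₁ K₂).toAddMonoidHom, hsm, fun a => map_D _ _ _ _ a, ?_, ?_⟩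
  · let e : Module.Basis (Fin g) K₂ Ω[K₂⁄k] := (isBaseChange_of_formallyEtale k K₁ K₂).basis θ₁
    have he : ∀ i, e i = map k k K₁ K₂ (θ₁ i) := fun i => IsBaseChange.basis_apply _ _ _
    have : (fun i => (map k k K₁ K₂).toAddMonoidHom (θ₁ i)) = e := funext fun i => (he i).symm
    rw [this]
    exact (θ₂.isUnit_det e).ne_zero
  · intro v
    have hv : ∀ i, (map k k K₁ K₂).toAddMonoidHom (v i)
        = ∑ j, ε (θ₁.repr (v i) j) • map k k K₁ K₂ (θ₁ j) := by
      intro i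
      conv_lhs => rw [← θ₁.sum_repr (v i)]
      rw [map_sum]
      exact Finset.sum_congr rfl fun j _ => hsm _ _
    have h2 : θ₂.toMatrix (fun i => (map k k K₁ K₂).toAddMonoidHom (v i)) =
        θ₂.toMatrix (fun i => (map k k K₁ K₂).toAddMonoidHom (θ₁ i)) *
          (θ₁.toMatrix v).map ε := by
      ext a i
      rw [Matrix.mul_apply, Module.Basis.toMatrix_apply, hv, map_sum, Finsupp.finsetSum_apply]
      refine Finset.sum_congr rfl fun j _ => ?_
      rw [map_smul, Finsupp.smul_apply, smul_eq_mul, mul_comm]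
      rfl
    rw [Module.Basis.det_apply, h2, Matrix.det_mul, Module.Basis.det_apply, Module.Basis.det_apply,
      mul_comm]
    congr 1
    exact (RingHom.map_det ε.toRingHom _).symm

end Pull

section Etale

open KaehlerDifferential TensorProduct

lemma formallyEtale_of_isUnit_det {k A B : Type*} [CommRing k] [CommRing A] [CommRing B]
    [Algebra k A] [Algebra k B] [Algebra A B] [IsScalarTower k A B] [Algebra.FormallySmooth k B]
    {g : ℕ} (bA : Module.Basis (Fin g) A Ω[A⁄k]) (bB : Module.Basis (Fin g) B Ω[B⁄k])
    (h : IsUnit (bB.toMatrix fun i => map k k A B (bA i)).det) :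
    Algebra.FormallyEtale A B := by
  obtain ⟨e, he⟩ : ∃ e : Module.Basis (Fin g) B Ω[B⁄k], ∀ i, e i = map k k A B (bA i) := by
    have := (Module.Basis.is_basis_iff_det bB (v := fun i => map k k A B (bA i))).2 h
    exact ⟨Module.Basis.mk this.1 this.2.ge, fun i => Module.Basis.mk_apply _ _ _⟩
  let E : B ⊗[A] Ω[A⁄k] ≃ₗ[B] Ω[B⁄k] := (bA.baseChange B).equiv e (Equiv.refl _)
  have hE : mapBaseChange k A B = E.toLinearMap := by
    refine (bA.baseChange B).ext fun i => ?_
    rw [LinearEquiv.coe_coe, Module.Basis.equiv_apply, Module.Basis.baseChange_apply,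
      mapBaseChange_tmul,
      one_smul, Equiv.refl_apply, he]
  have hbij : Function.Bijective (mapBaseChange k A B) := by rw [hE]; exact E.bijective
  refine ⟨⟨fun x y => ?_⟩, ⟨fun x y => ?_⟩⟩
  · have hz : ∀ z : Ω[B⁄A], z = 0 := by
      intro z
      obtain ⟨w, rfl⟩ := map_surjective k A B z
      exact (exact_mapBaseChange_map k A B w).2 (hbij.2 w)
    rw [hz x, hz y]
  · have hz : ∀ z : Algebra.H1Cotangent A B, z = 0 := by
      intro z
      have h1 : Algebra.H1Cotangent.δ k A B z = 0 := by
        apply hbij.1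
        rw [map_zero]
        exact (Algebra.H1Cotangent.exact_δ_mapBaseChange k A B _).2 ⟨z, rfl⟩
      obtain ⟨w, rfl⟩ := (Algebra.H1Cotangent.exact_map_δ k A B z).1 h1
      rw [Subsingleton.elim w 0, map_zero]
    rw [hz x, hz y]

lemma formallyEtale_of_jacobian_inv_mem {k K A B : Type*} [Field k] [Field K] [Algebra k K]
    [CommRing A] [CommRing B] [Algebra k A] [Algebra k B] [Algebra A B] [IsScalarTower k A B]
    [Algebra A K] [Algebra B K] [IsScalarTower k A K] [IsScalarTower k B K]
    [Algebra.FormallySmooth k B] (hBK : Function.Injective (algebraMap B K))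
    {g : ℕ} (bA : Module.Basis (Fin g) A Ω[A⁄k]) (bB : Module.Basis (Fin g) B Ω[B⁄k])
    (θ eA eB : Module.Basis (Fin g) K Ω[K⁄k])
    (heA : ∀ i, eA i = map k k A K (bA i)) (heB : ∀ i, eB i = map k k B K (bB i))
    (E : K →ₐ[k] K) (hE : ∀ a : A, E (algebraMap A K a) = algebraMap B K (algebraMap A B a))
    (P : Ω[K⁄k] →+ Ω[K⁄k]) (hP : ∀ c w, P (c • w) = E c • P w)
    (hPD : ∀ a, P (D k K a) = D k K (E a)) {J : K}
    (hPdet : ∀ v : Fin g → Ω[K⁄k], θ.det (fun i => P (v i)) = E (θ.det v) * J)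
    (hu : E (θ.det eA) * J ≠ 0)
    (hinv : (E (θ.det eA) * J / θ.det eB)⁻¹ ∈ Set.range (algebraMap B K)) :
    Algebra.FormallyEtale A B := by
  apply formallyEtale_of_isUnit_det bA bB
  have h1 : ∀ w : Ω[A⁄k], P (map k k A K w) = map k k B K (map k k A B w) := by
    intro w
    have hw : w ∈ Submodule.span A (Set.range (D k A)) := by
      rw [span_range_derivation]; trivial
    induction hw using Submodule.span_induction with
    | zero => simp
    | add a b _ _ ha hb => simp only [map_add, ha, hb]
    | smul c a _ ha =>
      have e1 : map k k A K (c • a) = algebraMap A K c • map k k A K a := by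
        rw [map_smul]; exact algebra_compatible_smul K c _
      have e2 : map k k A B (c • a) = algebraMap A B c • map k k A B a := by
        rw [map_smul]; exact algebra_compatible_smul B c _
      have e3 : ∀ (b : B) (v : Ω[B⁄k]), map k k B K (b • v) = algebraMap B K b • map k k B K v := by
        intro b v
        rw [map_smul]; exact algebra_compatible_smul K b _
      rw [e1, e2, e3, hP, ha, hE]
    | mem a ha =>
      obtain ⟨i, rfl⟩ := ha
      simp only [map_D, hPD, hE]
  set N := bB.toMatrix fun i => map k k A B (bA i) with hN
  have h2 : eB.toMatrix (fun i => P (eA i)) = N.map (algebraMap B K) := by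
    ext j i
    have h3 : P (eA i) = ∑ j, algebraMap B K (N j i) • eB j := by
      rw [heA, h1]
      conv_lhs => rw [← bB.sum_repr (map k k A B (bA i)), map_sum]
      refine Finset.sum_congr rfl fun j _ => ?_
      rw [map_smul, heB]
      exact algebra_compatible_smul K _ _
    rw [Module.Basis.toMatrix_apply, h3, eB.repr_sum_self]
    rfl
  have h4 : E (θ.det eA) * J = θ.det eB * algebraMap B K N.det := by
    rw [← hPdet, Module.Basis.det_apply, Module.Basis.det_apply,
      ← Module.Basis.toMatrix_mul_toMatrix θ eB, Matrix.det_mul, h2]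
    congr 1
    exact (RingHom.map_det _ _).symm
  have h5 : θ.det eB ≠ 0 := (θ.isUnit_det eB).ne_zero
  rw [h4, mul_div_cancel_left₀ _ h5] at hinv
  obtain ⟨v, hv⟩ := hinv
  have h6 : algebraMap B K N.det ≠ 0 := by
    intro h0; rw [h4, h0, mul_zero] at hu; exact hu rfl
  refine IsUnit.of_mul_eq_one v (hBK ?_)
  rw [map_mul, hv, mul_inv_cancel₀ h6, map_one]

/-- A domain which is étale over an integrally closed domain is integrally closed. -/
lemma isIntegrallyClosed_of_etale {A R : Type*} [CommRing A] [IsDomain A] [IsIntegrallyClosed A]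
    [CommRing R] [IsDomain R] [Algebra A R] [Algebra.Etale A R] : IsIntegrallyClosed R := by
  have hflat : Module.Flat A R := inferInstance
  have hinj : Function.Injective (algebraMap A R) := FaithfulSMul.algebraMap_injective A R
  let T := R ⊗[A] FractionRing A
  have hle : Algebra.algebraMapSubmonoid R (nonZeroDivisors A) ≤ nonZeroDivisors R := by
    rintro _ ⟨a, ha, rfl⟩
    refine mem_nonZeroDivisors_of_ne_zero fun h => nonZeroDivisors.ne_zero ha (hinj ?_)
    rw [map_zero]; exact h
  have hloc : IsLocalization (Algebra.algebraMapSubmonoid R (nonZeroDivisors A)) T := inferInstance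
  have hdom : IsDomain T := IsLocalization.isDomain_of_le_nonZeroDivisors T hle
  let e : T ≃+* FractionRing A ⊗[A] R := (Algebra.TensorProduct.comm A R (FractionRing A)).toRingEquiv
  have hdom' : IsDomain (FractionRing A ⊗[A] R) := e.symm.toMulEquiv.isDomain
  have hfin : Module.Finite (FractionRing A) (FractionRing A ⊗[A] R) :=
    Algebra.FormallyUnramified.finite_of_free _ _
  have hfield' : IsField (FractionRing A ⊗[A] R) :=
    isField_of_isIntegral_of_isField' (Field.toIsField (FractionRing A))
  have hfield : IsField T := e.toMulEquiv.isField hfield'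
  letI : Field T := hfield.toField
  have hRT : Function.Injective (algebraMap R T) := IsLocalization.injective T hle
  haveI : FaithfulSMul R T := (faithfulSMul_iff_algebraMap_injective R T).2 hRT
  haveI : IsFractionRing R T := by
    refine IsFractionRing.of_field R T fun z => ?_
    obtain ⟨x, s, rfl⟩ := IsLocalization.exists_mk'_eq
      (Algebra.algebraMapSubmonoid R (nonZeroDivisors A)) z
    refine ⟨x, s, ?_⟩
    have hs : algebraMap R T s ≠ 0 := by
      intro h
      exact nonZeroDivisors.ne_zero (hle s.2) (hRT (h.trans (map_zero _).symm))
    rw [eq_div_iff hs]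
    exact IsLocalization.mk'_spec T x s
  rw [isIntegrallyClosed_iff T]
  intro x hx
  obtain ⟨y, hy⟩ := (TensorProduct.toIntegralClosure_bijective_of_smooth
    (R := A) (S := R) (B := FractionRing A)).2 ⟨x, hx⟩
  have hy' : _ = x := congrArg Subtype.val hy
  rw [← hy']
  clear hy hy'
  induction y with
  | zero => exact ⟨0, by simp⟩
  | add a b ha hb =>
    obtain ⟨u, hu⟩ := ha
    obtain ⟨v, hv⟩ := hb
    exact ⟨u + v, by simp only [map_add, hu, hv]; rfl⟩
  | tmul r b =>
    obtain ⟨a, ha⟩ := IsIntegrallyClosed.isIntegral_iff.1 b.2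
    refine ⟨a • r, ?_⟩
    have h2 : ((TensorProduct.toIntegralClosure A R (FractionRing A) (r ⊗ₜ b) :
      integralClosure R (R ⊗[A] FractionRing A)) : R ⊗[A] FractionRing A) =
        r ⊗ₜ (b : FractionRing A) := rfl
    have h3 : (algebraMap A (FractionRing A) a) = a • (1 : FractionRing A) :=
      Algebra.algebraMap_eq_smul_one a
    rw [h2, ← ha, h3, ← TensorProduct.smul_tmul]
    rfl

lemma isIntegrallyClosed_of_isStandardSmooth {k R : Type*} [Field k] [CommRing R] [IsDomain R]
    [Algebra k R] [Algebra.IsStandardSmooth k R] : IsIntegrallyClosed R := by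
  obtain ⟨n, φ, -, hg⟩ := RingHom.IsStandardSmooth.exists_etale_mvPolynomial
    (f := algebraMap k R) (by simpa [RingHom.isStandardSmooth_algebraMap])
  algebraize [φ]
  exact isIntegrallyClosed_of_etale (A := MvPolynomial (Fin n) k)

end Etale

section FunctionField

variable {k : Type u} [Field k] {X : Scheme.{u}} [IsIntegral X]

/-- The function field of an integral scheme over `k`, as a `k`-algebra. -/
def FF (_ : X ⟶ Spec (CommRingCat.of k)) : Type u := X.functionField

variable (sX : X ⟶ Spec (CommRingCat.of k))

instance : Field (FF sX) := inferInstanceAs (Field X.functionField)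

lemma genericPoint_mem {U : X.Opens} {x : X} (hx : x ∈ U) : genericPoint X ∈ U :=
  ((genericPoint_spec X).mem_open_set_iff U.isOpen).2 ⟨x, trivial, hx⟩

/-- The inclusion of the sections over a nonempty open in the function field. -/
def gm (U : X.Opens) (hU : genericPoint X ∈ U) : Γ(X, U) →+* FF sX :=
  (X.presheaf.germ U (genericPoint X) hU).hom

lemma gm_injective (U : X.Opens) (hU : genericPoint X ∈ U) : Function.Injective (gm sX U hU) :=
  germ_injective_of_isIntegral _ _ _

lemma gm_sres {U V : X.Opens} (h : V ≤ U) (hV : genericPoint X ∈ V) (s : Γ(X, U)) :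
    gm sX V hV (sres X h s) = gm sX U (h hV) s :=
  X.presheaf.germ_res_apply (homOfLE h) (genericPoint X) hV s

instance : Algebra k (FF sX) := ((gm sX ⊤ trivial).comp (LineBundle.toSections sX ⊤)).toAlgebra

lemma gm_toSections (U : X.Opens) (hU : genericPoint X ∈ U) (c : k) :
    gm sX U hU (LineBundle.toSections sX U c) = algebraMap k (FF sX) c := by
  rw [← LineBundle.sres_toSections sX (le_top : U ≤ ⊤), gm_sres]
  rfl

/-- The inclusion of a stalk in the function field. -/
def stalkIncl (x : X) : X.presheaf.stalk x →+* FF sX :=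
  (X.presheaf.stalkSpecializes ((genericPoint_spec X).specializes trivial)).hom

lemma stalkIncl_germ {U : X.Opens} {x : X} (hx : x ∈ U) (s : Γ(X, U)) :
    stalkIncl sX x (X.presheaf.germ U x hx s) = gm sX U (genericPoint_mem hx) s :=
  haveI : Nonempty U := ⟨⟨x, hx⟩⟩
  Scheme.algebraMap_germ_eq_germToFunctionField X hx s

lemma stalkIncl_injective (x : X) : Function.Injective (stalkIncl sX x) :=
  IsFractionRing.injective (X.presheaf.stalk x) X.functionField

/-- The local ring at `x`, as a subalgebra of the function field. -/
def locRing (x : X) : Subalgebra k (FF sX) :=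
  { (stalkIncl sX x).range with
    algebraMap_mem' := fun c => by
      refine ⟨X.presheaf.germ ⊤ x trivial (LineBundle.toSections sX ⊤ c), ?_⟩
      exact (stalkIncl_germ sX (U := ⊤) trivial _).trans (gm_toSections sX ⊤ trivial c) }

lemma gm_mem_locRing {U : X.Opens} {x : X} (hx : x ∈ U) (hU : genericPoint X ∈ U) (s : Γ(X, U)) :
    gm sX U hU s ∈ locRing sX x :=
  ⟨_, stalkIncl_germ sX hx s⟩

lemma exists_gm_of_mem_locRing {x : X} {f : FF sX} (h : f ∈ locRing sX x) :
    ∃ (U : X.Opens) (hx : x ∈ U) (s : Γ(X, U)), gm sX U (genericPoint_mem hx) s = f := by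
  obtain ⟨a, rfl⟩ := h
  obtain ⟨U, hx, s, rfl⟩ := X.presheaf.exists_germ_eq a
  exact ⟨U, hx, s, (stalkIncl_germ sX hx s).symm⟩

/-- The local ring at `x` is isomorphic to the stalk. -/
def stalkEquiv (x : X) : X.presheaf.stalk x ≃+* locRing sX x :=
  RingEquiv.ofBijective ((stalkIncl sX x).codRestrict (locRing sX x) fun a => ⟨a, rfl⟩)
    ⟨fun _ _ h => stalkIncl_injective sX x (congrArg Subtype.val h),
      fun ⟨_, a, ha⟩ => ⟨a, Subtype.ext ha⟩⟩

instance (x : X) : IsLocalRing (locRing sX x) := (stalkEquiv sX x).isLocalRing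

instance [IsLocallyNoetherian X] (x : X) : IsNoetherianRing (locRing sX x) :=
  isNoetherianRing_of_ringEquiv _ (stalkEquiv sX x)

lemma isOpen_setOf_mem_locRing (f : FF sX) : IsOpen {x | f ∈ locRing sX x} := by
  rw [isOpen_iff_forall_mem_open]
  intro x hx
  obtain ⟨U, hxU, s, rfl⟩ := exists_gm_of_mem_locRing sX hx
  exact ⟨U, fun y hy => gm_mem_locRing sX hy _ s, U.isOpen, hxU⟩

lemma locRing_genericPoint : locRing sX (genericPoint X) = ⊤ := by
  rw [eq_top_iff]
  intro f _
  obtain ⟨U, hU, s, rfl⟩ := X.presheaf.exists_germ_eq (f : X.functionField)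
  exact gm_mem_locRing sX hU hU s

/-- A rational function which is regular at all points of `U` is a section over `U`. -/
lemma exists_gm_of_forall_mem_locRing {U : X.Opens} (hU : genericPoint X ∈ U) {f : FF sX}
    (h : ∀ x ∈ U, f ∈ locRing sX x) : ∃ s, gm sX U hU s = f := by
  choose V hV s hs using fun x : U => exists_gm_of_mem_locRing sX (h x x.2)
  let W : U → X.Opens := fun x => V x ⊓ U
  let t : ∀ x : U, Γ(X, W x) := fun x => sres X inf_le_left (s x)
  have ht : ∀ x (hW : genericPoint X ∈ W x), gm sX (W x) hW (t x) = f := by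
    intro x hW
    rw [gm_sres, hs]
  have hη : ∀ x y, genericPoint X ∈ W x ⊓ W y := fun x y =>
    ⟨⟨genericPoint_mem (hV x), hU⟩, ⟨genericPoint_mem (hV y), hU⟩⟩
  obtain ⟨g, hg, -⟩ := X.sheaf.existsUnique_gluing' W U (fun x => homOfLE inf_le_right)
    (fun x hx => TopologicalSpace.Opens.mem_iSup.2 ⟨⟨x, hx⟩, hV ⟨x, hx⟩, hx⟩) t (by
      intro x y
      apply gm_injective sX _ (hη x y)
      exact ((gm_sres sX inf_le_left (hη x y) (t x)).trans (ht x _)).trans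
        ((gm_sres sX inf_le_right (hη x y) (t y)).trans (ht y _)).symm)
  refine ⟨g, ?_⟩
  have h1 := hg ⟨_, hU⟩
  rw [← ht ⟨_, hU⟩ ⟨hV _, hU⟩, ← h1]
  exact (gm_sres sX inf_le_right _ g).symm

end FunctionField

section SelfMap

lemma app_toSections {k : Type u} [Field k] {X : Scheme.{u}}
    {sX : X ⟶ Spec (CommRingCat.of k)} {φ : X ⟶ X} (hφ : φ ≫ sX = sX) (c : k) :
    φ.app ⊤ (LineBundle.toSections sX ⊤ c) = LineBundle.toSections sX ⊤ c := by
  have h1 : sX.appTop ≫ φ.appTop = sX.appTop := by rw [← Scheme.Hom.comp_appTop, hφ]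
  have h2 : ∀ a : Γ(X, ⊤), sres X le_rfl a = a := fun a => by
    simp [sres]
  simp only [LineBundle.toSections, RingHom.comp_apply, h2]
  exact congr($h1 _)

variable {k : Type u} [Field k] {X : Scheme.{u}} [IsIntegral X]
  {sX : X ⟶ Spec (CommRingCat.of k)}

theorem exists_pullback_functionField (φ : X ⟶ X) (hφ : φ ≫ sX = sX)
    (hsep : IsSeparableSelfMap φ) :
    ∃ E : FF sX →ₐ[k] FF sX,
      (∀ (U : X.Opens) (hU : genericPoint X ∈ U) (hU' : genericPoint X ∈ φ ⁻¹ᵁ U) (s : Γ(X, U)),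
        E (gm sX U hU s) = gm sX (φ ⁻¹ᵁ U) hU' (φ.app U s)) ∧
      @Algebra.IsSeparable (FF sX) (FF sX) _ _ E.toRingHom.toAlgebra := by
  obtain ⟨h, hs⟩ := hsep
  let E₀ : X.functionField ⟶ X.functionField :=
    (X.presheaf.stalkCongr (Inseparable.of_eq h.symm)).hom ≫ φ.stalkMap (genericPoint X)
  have key : ∀ (U : X.Opens) (hU : genericPoint X ∈ U) (hU' : genericPoint X ∈ φ ⁻¹ᵁ U)
      (s : Γ(X, U)), (E₀.hom (X.presheaf.germ U _ hU s) : X.functionField) =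
        X.presheaf.germ (φ ⁻¹ᵁ U) _ hU' (φ.app U s) := by
    intro U hU hU' s
    have h1 : X.presheaf.germ U _ hU ≫ E₀ = φ.app U ≫ X.presheaf.germ (φ ⁻¹ᵁ U) _ hU' := by
      refine Eq.trans ?_ (Scheme.Hom.germ_stalkMap φ U (genericPoint X) hU')
      have h2 := TopCat.Presheaf.germ_stalkSpecializes X.presheaf hU
        (show φ.base (genericPoint X) ⤳ genericPoint X from (Inseparable.of_eq h).specializes)
      exact (Category.assoc _ _ _).symm.trans (congrArg (· ≫ φ.stalkMap (genericPoint X)) h2)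
    exact congr($h1 s)
  let E : FF sX →ₐ[k] FF sX :=
    { (E₀.hom : X.functionField →+* X.functionField) with
      commutes' := fun c => by
        have h1 := key ⊤ trivial trivial (LineBundle.toSections sX ⊤ c)
        rw [app_toSections hφ] at h1
        exact h1 }
  exact ⟨E, key, hs⟩

variable {φ : X ⟶ X} {E : FF sX →ₐ[k] FF sX}

lemma pullback_mem_locRing
    (hE : ∀ (U : X.Opens) (hU : genericPoint X ∈ U) (hU' : genericPoint X ∈ φ ⁻¹ᵁ U) (s : Γ(X, U)),
      E (gm sX U hU s) = gm sX (φ ⁻¹ᵁ U) hU' (φ.app U s)) {x : X} {f : FF sX}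
    (hf : f ∈ locRing sX (φ x)) : E f ∈ locRing sX x := by
  obtain ⟨U, hU, s, rfl⟩ := exists_gm_of_mem_locRing sX hf
  have hx : x ∈ φ ⁻¹ᵁ U := hU
  rw [hE _ _ (genericPoint_mem hx)]
  exact gm_mem_locRing sX hx _ _

lemma inv_mem_locRing_of_pullback
    (hE : ∀ (U : X.Opens) (hU : genericPoint X ∈ U) (hU' : genericPoint X ∈ φ ⁻¹ᵁ U) (s : Γ(X, U)),
      E (gm sX U hU s) = gm sX (φ ⁻¹ᵁ U) hU' (φ.app U s)) {x : X} {f : FF sX}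
    (hf : f ∈ locRing sX (φ x)) (hf' : (E f)⁻¹ ∈ locRing sX x) : f⁻¹ ∈ locRing sX (φ x) := by
  rcases eq_or_ne f 0 with rfl | h0
  · simp
  obtain ⟨U, hU, s, rfl⟩ := exists_gm_of_mem_locRing sX hf
  have hx : x ∈ φ ⁻¹ᵁ U := hU
  have h1 : E (gm sX U (genericPoint_mem hU) s) =
      stalkIncl sX x (φ.stalkMap x (X.presheaf.germ U (φ x) hU s)) := by
    have h2 : φ.stalkMap x (X.presheaf.germ U (φ x) hU s) =
        X.presheaf.germ (φ ⁻¹ᵁ U) x hx (φ.app U s) :=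
      congr($(Scheme.Hom.germ_stalkMap φ U x hU) s)
    rw [hE _ _ (genericPoint_mem hx), h2]
    exact (stalkIncl_germ sX hx _).symm
  have h3 : E (gm sX U (genericPoint_mem hU) s) ≠ 0 := by
    rwa [Ne, map_eq_zero_iff E E.toRingHom.injective]
  obtain ⟨b, hb⟩ := hf'
  have h4 : IsUnit (φ.stalkMap x (X.presheaf.germ U (φ x) hU s)) := by
    refine IsUnit.of_mul_eq_one b (stalkIncl_injective sX x ?_)
    rw [map_mul, ← h1, map_one]
    refine Eq.trans ?_ (mul_inv_cancel₀ h3)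
    exact congrArg _ hb
  have h5 : IsUnit (X.presheaf.germ U (φ x) hU s) := isUnit_of_map_unit (φ.stalkMap x).hom _ h4
  obtain ⟨c, hc⟩ := h5.exists_right_inv
  refine ⟨c, ?_⟩
  refine eq_inv_of_mul_eq_one_right ?_
  have h6 := congrArg (stalkIncl sX (φ x)) hc
  rw [map_mul, map_one] at h6
  rw [← h6]
  congr 1
  exact (stalkIncl_germ sX hU s).symm

end SelfMap

section AffineCharts

variable {k : Type u} [Field k] {X : Scheme.{u}} [IsIntegral X]
  (sX : X ⟶ Spec (CommRingCat.of k))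

lemma inv_gm_mem_locRing_iff {U : X.Opens} {x : X} (hx : x ∈ U) (hU : genericPoint X ∈ U)
    {b : Γ(X, U)} (hb : b ≠ 0) : (gm sX U hU b)⁻¹ ∈ locRing sX x ↔ x ∈ X.basicOpen b := by
  have hb' : gm sX U hU b ≠ 0 := by
    rwa [Ne, map_eq_zero_iff _ (gm_injective sX U hU)]
  rw [X.mem_basicOpen b x hx]
  constructor
  · rintro ⟨c, hc⟩
    refine IsUnit.of_mul_eq_one c (stalkIncl_injective sX x ?_)
    rw [map_mul, map_one]
    refine Eq.trans ?_ (mul_inv_cancel₀ hb')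
    congr 1
    exact stalkIncl_germ sX hx b
  · intro h
    obtain ⟨c, hc⟩ := h.exists_right_inv
    refine ⟨c, eq_inv_of_mul_eq_one_right ?_⟩
    have h6 := congrArg (stalkIncl sX x) hc
    rw [map_mul, map_one] at h6
    rw [← h6]
    congr 1
    exact (stalkIncl_germ sX hx b).symm

lemma exists_div_of_mem_locRing {U : X.Opens} (hUa : IsAffineOpen U) {x : X} (hx : x ∈ U)
    (hU : genericPoint X ∈ U) {f : FF sX} (hf : f ∈ locRing sX x) :
    ∃ a s : Γ(X, U), s ≠ 0 ∧ (gm sX U hU s)⁻¹ ∈ locRing sX x ∧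
      f = gm sX U hU a / gm sX U hU s := by
  obtain ⟨b, rfl⟩ := hf
  letI := TopCat.Presheaf.algebra_section_stalk X.presheaf (⟨x, hx⟩ : U)
  have := hUa.isLocalization_stalk ⟨x, hx⟩
  obtain ⟨a, s, h⟩ := IsLocalization.exists_mk'_eq
    (hUa.primeIdealOf ⟨x, hx⟩).asIdeal.primeCompl b
  have hu : IsUnit (X.presheaf.germ U x hx s.1) := IsLocalization.map_units _ s
  have h1 : b * X.presheaf.germ U x hx s.1 = X.presheaf.germ U x hx a := by
    rw [← h]
    exact IsLocalization.mk'_spec _ a s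
  have h2 := congrArg (stalkIncl sX x) h1
  have h3 := (map_mul (stalkIncl sX x) b (X.presheaf.germ U x hx s.1)).symm.trans h2
  have hs0 : s.1 ≠ 0 := by
    intro h0
    rw [h0, map_zero] at hu
    exact not_isUnit_zero hu
  have hs0' : gm sX U hU s.1 ≠ 0 := by
    rwa [Ne, map_eq_zero_iff _ (gm_injective sX U hU)]
  refine ⟨a, s.1, hs0, (inv_gm_mem_locRing_iff sX hx hU hs0).2 ((X.mem_basicOpen _ x hx).2 hu), ?_⟩
  rw [eq_div_iff hs0']
  rw [stalkIncl_germ, stalkIncl_germ] at h3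
  exact h3

theorem exists_codim_one_specialization [IsLocallyNoetherian X] (x : X) (a : FF sX)
    (ha : a ∈ maxPow (locRing sX x) 1) (ha0 : a ≠ 0) :
    ∃ y, y ⤳ x ∧ a ∈ maxPow (locRing sX y) 1 ∧ ∀ z, z ⤳ y → z = y ∨ locRing sX z = ⊤ := by
  rw [mem_maxPow_one] at ha
  obtain ⟨haO, ha'⟩ := ha
  replace ha' := ha'.resolve_left ha0
  obtain ⟨V, hxV, s, hs⟩ := exists_gm_of_mem_locRing sX haO
  obtain ⟨_, ⟨U, hUa, rfl⟩, hxU, hUV⟩ :=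
    X.isBasis_affineOpens.exists_subset_of_mem_open hxV V.isOpen
  replace hUa : IsAffineOpen U := hUa
  have hUη : genericPoint X ∈ U := genericPoint_mem hxU
  obtain ⟨b, rfl⟩ : ∃ b, gm sX U hUη b = a :=
    ⟨sres X (show U ≤ V from hUV) s, (gm_sres sX (show U ≤ V from hUV) hUη s).trans hs⟩
  have hb0 : b ≠ 0 := by rintro rfl; exact ha0 (map_zero _)
  have hdom : IsDomain Γ(X, U) := (gm_injective sX U hUη).isDomain _
  have hnoeth : IsNoetherianRing Γ(X, U) := IsLocallyNoetherian.component_noetherian ⟨U, hUa⟩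
  have hmemU : ∀ q : PrimeSpectrum Γ(X, U), hUa.fromSpec q ∈ U := fun q =>
    hUa.range_fromSpec.le ⟨q, rfl⟩
  have hbasic : ∀ q : PrimeSpectrum Γ(X, U), hUa.fromSpec q ∈ X.basicOpen b ↔ b ∉ q.asIdeal :=
    fun q => by
      have h1 := hUa.fromSpec_preimage_basicOpen b
      exact (SetLike.ext_iff.1 h1 q)
  have hspec : ∀ q r : PrimeSpectrum Γ(X, U), hUa.fromSpec q ⤳ hUa.fromSpec r ↔ q ≤ r :=
    fun q r => by
      rw [PrimeSpectrum.le_iff_specializes]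
      exact hUa.fromSpec.isOpenEmbedding.isInducing.specializes_iff
  obtain ⟨p, hp⟩ : ∃ p : PrimeSpectrum Γ(X, U), hUa.fromSpec p = x := by
    have : x ∈ Set.range hUa.fromSpec := by rw [hUa.range_fromSpec]; exact hxU
    exact this
  have hbp : b ∈ p.asIdeal := by
    by_contra h
    rw [← hbasic, hp, ← inv_gm_mem_locRing_iff sX hxU hUη hb0] at h
    exact ha' h
  obtain ⟨q, hq, hqp⟩ := Ideal.exists_minimalPrimes_le
    (I := Ideal.span {b}) (J := p.asIdeal) ((Ideal.span_singleton_le_iff_mem _).2 hbp)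
  have hqprime : q.IsPrime := hq.1.1
  have hqht : q.height ≤ 1 := Ideal.height_le_one_of_isPrincipal_of_mem_minimalPrimes _ q hq
  have hbq : b ∈ q := (Ideal.span_singleton_le_iff_mem _).1 hq.1.2
  let Q : PrimeSpectrum Γ(X, U) := ⟨q, hqprime⟩
  refine ⟨hUa.fromSpec Q, ?_, ?_, ?_⟩
  · rw [← hp, hspec]; exact hqp
  · rw [mem_maxPow_one]
    refine ⟨gm_mem_locRing sX (hmemU Q) _ _, Or.inr ?_⟩
    rw [inv_gm_mem_locRing_iff sX (hmemU Q) hUη hb0, hbasic]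
    exact fun h => h hbq
  · intro z hz
    obtain ⟨r, rfl⟩ : ∃ r : PrimeSpectrum Γ(X, U), hUa.fromSpec r = z := by
      have : z ∈ Set.range hUa.fromSpec := by
        rw [hUa.range_fromSpec]; exact hz.mem_open U.isOpen (hmemU Q)
      exact this
    rw [hspec] at hz
    rcases hz.eq_or_lt with h | h
    · exact Or.inl (by rw [h])
    · right
      have h1 : r.asIdeal.height < 1 :=
        (Ideal.height_le_iff (p := q) (n := 1)).1 hqht _ r.isPrime h
      have h2 : r.asIdeal = ⊥ := by
        by_contra hne
        exact not_lt_bot ((Ideal.height_le_iff (p := r.asIdeal) (n := 0)).1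
          (Order.lt_one_iff.1 h1).le ⊥ Ideal.isPrime_bot (bot_lt_iff_ne_bot.2 hne))
      obtain ⟨w, hw⟩ : ∃ w : PrimeSpectrum Γ(X, U), hUa.fromSpec w = genericPoint X := by
        have : genericPoint X ∈ Set.range hUa.fromSpec := by rw [hUa.range_fromSpec]; exact hUη
        exact this
      have h3 : hUa.fromSpec r = genericPoint X := by
        have h4 : hUa.fromSpec r ⤳ genericPoint X := by
          rw [← hw, hspec]
          change r.asIdeal ≤ _
          rw [h2]; exact bot_le
        exact (h4.antisymm ((genericPoint_spec X).specializes trivial)).eq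
      rw [h3, locRing_genericPoint]

end AffineCharts

section Dimension

lemma ringKrullDim_le_of_isIntegral {R S : Type*} [CommRing R] [CommRing S] [Algebra R S]
    [Algebra.IsIntegral R S] (hinj : Function.Injective (algebraMap R S)) :
    ringKrullDim R ≤ ringKrullDim S := by
  refine iSup_le fun l => ?_
  obtain ⟨P, hP, hPl⟩ := Ideal.exists_ideal_over_prime_of_isIntegral (S := S)
    (RelSeries.head l).asIdeal ⊥ (by
      rw [← RingHom.ker_eq_comap_bot, (RingHom.injective_iff_ker_eq_bot _).1 hinj]
      exact bot_le)
  haveI := hPl.1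
  haveI : P.LiesOver (RelSeries.head l).asIdeal := ⟨hPl.2.symm⟩
  obtain ⟨M, hM, -⟩ := Ideal.exists_ltSeries_of_hasGoingUp l P
  rw [← hM]
  exact Order.LTSeries.length_le_krullDim M

lemma trdeg_le_ringKrullDim {k R K : Type u} [Field k] [CommRing R] [Nontrivial R] [Algebra k R]
    [Algebra.FiniteType k R] [Field K] [Algebra k K] [Algebra R K] [IsScalarTower k R K]
    [IsFractionRing R K] {n : ℕ} (h : ringKrullDim R ≤ n) : Algebra.trdeg k K ≤ n := by
  obtain ⟨s, f, hinj, hfin⟩ := exists_finite_inj_algHom_of_fg k R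
  letI := f.toRingHom.toAlgebra
  haveI : Module.Finite (MvPolynomial (Fin s) k) R := hfin
  haveI : IsScalarTower k (MvPolynomial (Fin s) k) R :=
    IsScalarTower.of_algebraMap_eq fun c => (f.commutes c).symm
  have h1 := (ringKrullDim_le_of_isIntegral (R := MvPolynomial (Fin s) k) (S := R) hinj).trans h
  rw [MvPolynomial.ringKrullDim_of_isNoetherianRing, ringKrullDim_eq_zero_of_field] at h1
  have hs : s ≤ n := by
    simpa using h1
  letI : Algebra (MvPolynomial (Fin s) k) K :=
    ((algebraMap R K).comp (algebraMap (MvPolynomial (Fin s) k) R)).toAlgebra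
  haveI : IsScalarTower (MvPolynomial (Fin s) k) R K := IsScalarTower.of_algebraMap_eq' rfl
  haveI : IsScalarTower k (MvPolynomial (Fin s) k) K :=
    IsScalarTower.of_algebraMap_eq fun c => by
      rw [IsScalarTower.algebraMap_apply k R K,
        IsScalarTower.algebraMap_apply k (MvPolynomial (Fin s) k) R,
        ← IsScalarTower.algebraMap_apply (MvPolynomial (Fin s) k) R K]
  haveI : IsDomain R := (IsFractionRing.injective R K).isDomain (algebraMap R K)
  haveI : FaithfulSMul (MvPolynomial (Fin s) k) K :=
    (faithfulSMul_iff_algebraMap_injective _ _).2 ((IsFractionRing.injective R K).comp hinj)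
  haveI : Algebra.IsAlgebraic R K := IsLocalization.isAlgebraic K (nonZeroDivisors R)
  haveI : Algebra.IsAlgebraic (MvPolynomial (Fin s) k) K :=
    Algebra.IsIntegral.trans_isAlgebraic (MvPolynomial (Fin s) k) R K
  rw [← trdeg_add_eq k (MvPolynomial (Fin s) k) (A := K),
    trdeg_eq_zero (R := MvPolynomial (Fin s) k),
    MvPolynomial.trdeg_of_isDomain]
  simpa using hs

lemma toSections_eq_appLE {k : Type u} [Field k] {X : Scheme.{u}}
    (sX : X ⟶ Spec (CommRingCat.of k)) (U : X.Opens) :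
    LineBundle.toSections sX U = (sX.appLE ⊤ U le_top).hom.comp
      (Scheme.ΓSpecIso (CommRingCat.of k)).inv.hom := by
  rfl

lemma trdeg_functionField_le {k : Type u} [Field k] {X : Scheme.{u}} [IsIntegral X]
    (sX : X ⟶ Spec (CommRingCat.of k)) [LocallyOfFiniteType sX] {g : ℕ}
    (hdim : topologicalKrullDim X = (g : ℕ∞)) : Algebra.trdeg k (FF sX) ≤ g := by
  obtain ⟨_, ⟨U, hU, rfl⟩, hη, -⟩ := X.isBasis_affineOpens.exists_subset_of_mem_open
    (Set.mem_univ (genericPoint X)) isOpen_univ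
  replace hU : IsAffineOpen U := hU
  replace hη : genericPoint X ∈ U := hη
  letI : Algebra k Γ(X, U) := (LineBundle.toSections sX U).toAlgebra
  letI : Algebra Γ(X, U) (FF sX) := (gm sX U hη).toAlgebra
  haveI : IsScalarTower k Γ(X, U) (FF sX) :=
    IsScalarTower.of_algebraMap_eq fun c => (gm_toSections sX U hη c).symm
  haveI : Nonempty U := ⟨⟨_, hη⟩⟩
  haveI : IsFractionRing Γ(X, U) (FF sX) := functionField_isFractionRing_of_isAffineOpen X U hU
  haveI : Algebra.FiniteType k Γ(X, U) := by
    rw [← RingHom.finiteType_algebraMap]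
    show RingHom.FiniteType (LineBundle.toSections sX U)
    rw [toSections_eq_appLE]
    exact (sX.finiteType_appLE (isAffineOpen_top _) hU le_top).comp (.of_surjective _
      (Scheme.ΓSpecIso (CommRingCat.of k)).symm.commRingCatIsoToRingEquiv.surjective)
  refine trdeg_le_ringKrullDim (R := Γ(X, U)) ?_
  rw [← PrimeSpectrum.topologicalKrullDim_eq_ringKrullDim]
  exact (hU.fromSpec.isOpenEmbedding.isInducing.topologicalKrullDim_le).trans hdim.le

end Dimension

section Proper

lemma degreeZeroInclusion_surjective (k : Type u) [Field k] (N : ℕ) :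
    Function.Surjective (degreeZeroInclusion k N) := by
  rintro ⟨p, hp⟩
  refine ⟨MvPolynomial.coeff 0 p, Subtype.ext ?_⟩
  exact (MvPolynomial.totalDegree_eq_zero_iff_eq_C.1
    (Nat.le_zero.1 (MvPolynomial.IsHomogeneous.totalDegree_le hp))).symm

instance (k : Type u) [Field k] (N : ℕ) :
    Algebra.FiniteType (MvPolynomial.homogeneousSubmodule (Fin (N + 1)) k 0)
      (MvPolynomial (Fin (N + 1)) k) :=
  haveI : IsScalarTower k (MvPolynomial.homogeneousSubmodule (Fin (N + 1)) k 0)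
    (MvPolynomial (Fin (N + 1)) k) := ⟨fun a b c => smul_mul_assoc a (b : MvPolynomial (Fin (N + 1)) k) c⟩
  Algebra.FiniteType.of_restrictScalars_finiteType k _ _

instance (k : Type u) [Field k] (N : ℕ) : IsProper (ProjSpace.str k N) := by
  haveI : IsClosedImmersion (Spec.map (CommRingCat.ofHom (degreeZeroInclusion k N))) :=
    IsClosedImmersion.spec_of_surjective _ (degreeZeroInclusion_surjective k N)
  unfold ProjSpace.str
  have h : IsProper (Proj.toSpecZero (MvPolynomial.homogeneousSubmodule (Fin (N + 1)) k)) :=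
    inferInstance
  have h' : IsProper (Spec.map (CommRingCat.ofHom (degreeZeroInclusion k N))) := inferInstance
  exact MorphismProperty.comp_mem @IsProper _ _ h h'

lemma IsProjectiveVariety.isProper {k : Type u} [Field k] {X : Scheme.{u}}
    {sX : X ⟶ Spec (CommRingCat.of k)} (hX : IsProjectiveVariety sX) : IsProper sX := by
  obtain ⟨-, N, ι, hι, rfl⟩ := hX
  infer_instance

lemma IsProjectiveVariety.surjective {k : Type u} [Field k] {X : Scheme.{u}} [IsIntegral X]
    {sX : X ⟶ Spec (CommRingCat.of k)} (hX : IsProjectiveVariety sX) {φ : X ⟶ X}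
    (hφ : φ ≫ sX = sX) (h : φ (genericPoint X) = genericPoint X) : Function.Surjective φ := by
  haveI := hX.isProper
  haveI : IsProper (φ ≫ sX) := by rwa [hφ]
  haveI : IsProper φ := IsProper.of_comp φ sX
  have hc : IsClosed (Set.range φ) := φ.isClosedMap.isClosed_range
  rw [← Set.range_eq_univ, ← hc.closure_eq, ← Set.univ_subset_iff,
    ← show closure {genericPoint X} = Set.univ from genericPoint_spec X]
  exact closure_mono (Set.singleton_subset_iff.2 ⟨_, h⟩)

end Proper

section Filtration

open LineBundle

section ProjCharts

variable {k : Type u} [Field k] {N : ℕ}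

open HomogeneousLocalization in
lemma adjoin_away_X_eq_top (j : Fin (N + 1)) :
    Algebra.adjoin (MvPolynomial.homogeneousSubmodule (Fin (N + 1)) k 0)
      (Set.range fun i => Away.mk (MvPolynomial.homogeneousSubmodule (Fin (N + 1)) k)
        (MvPolynomial.isHomogeneous_X k j) 1 (MvPolynomial.X i)
        (by simpa using MvPolynomial.isHomogeneous_X k i)) = ⊤ := by
  have hX : Algebra.adjoin (MvPolynomial.homogeneousSubmodule (Fin (N + 1)) k 0)
      (Set.range (MvPolynomial.X : Fin (N + 1) → MvPolynomial (Fin (N + 1)) k)) = ⊤ := by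
    refine eq_top_iff.2 fun p _ => ?_
    induction p using MvPolynomial.induction_on with
    | C c => exact Subalgebra.algebraMap_mem _ (degreeZeroInclusion k N c)
    | add p q hp hq => exact add_mem (hp trivial) (hq trivial)
    | mul_X p i hp => exact mul_mem (hp trivial) (Algebra.subset_adjoin ⟨i, rfl⟩)
  have hspan := Away.span_mk_prod_pow_eq_top (𝒜 := MvPolynomial.homogeneousSubmodule (Fin (N + 1)) k)
    (MvPolynomial.isHomogeneous_X k j) MvPolynomial.X hX (fun _ => 1)
    (fun i => MvPolynomial.isHomogeneous_X k i)
  rw [← top_le_iff]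
  change ⊤ ≤ (Algebra.adjoin (MvPolynomial.homogeneousSubmodule (Fin (N + 1)) k 0) _).toSubmodule
  rw [← hspan, Submodule.span_le]
  rintro _ ⟨a, ai, hai, rfl⟩
  have key : Away.mk (MvPolynomial.homogeneousSubmodule (Fin (N + 1)) k)
      (MvPolynomial.isHomogeneous_X k j) a (∏ i, MvPolynomial.X i ^ ai i)
        (hai ▸ SetLike.prod_pow_mem_graded _ _ _ _ fun i _ => MvPolynomial.isHomogeneous_X k i) =
      ∏ i, Away.mk (MvPolynomial.homogeneousSubmodule (Fin (N + 1)) k)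
        (MvPolynomial.isHomogeneous_X k j) 1 (MvPolynomial.X i)
        (by simpa using MvPolynomial.isHomogeneous_X k i) ^ ai i := by
    apply HomogeneousLocalization.val_injective
    rw [← HomogeneousLocalization.algebraMap_apply, ← HomogeneousLocalization.algebraMap_apply,
      map_prod]
    simp_rw [map_pow]
    refine Eq.trans (b := Localization.mk (∏ i, MvPolynomial.X i ^ ai i)
      (∏ i, (⟨MvPolynomial.X j ^ 1, 1, rfl⟩ : Submonoid.powers
        (MvPolynomial.X j : MvPolynomial (Fin (N + 1)) k)) ^ ai i)) ?_ ?_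
    · refine (HomogeneousLocalization.Away.val_mk _ _ (MvPolynomial.isHomogeneous_X k j) _ _).trans ?_
      congr 1
      apply Subtype.ext
      simp only [smul_eq_mul, mul_one] at hai
      simp [Finset.prod_pow_eq_pow_sum, hai]
    · rw [← Localization.mk_prod]
      refine Finset.prod_congr rfl fun i _ => ?_
      rw [← Localization.mk_pow]
      rfl
  rw [key]
  exact Subalgebra.prod_mem _ fun i _ => Subalgebra.pow_mem _ (Algebra.subset_adjoin (Set.mem_range_self i)) _

end ProjCharts

lemma ΓSpecIso_inv_appLE_of_ι_comp {X : Scheme.{u}} {R : CommRingCat.{u}} (f : X ⟶ Spec R)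
    (U : X.Opens) (ψ : R ⟶ Γ(X, U)) (h : U.ι ≫ f = U.toSpecΓ ≫ Spec.map ψ) :
    (Scheme.ΓSpecIso R).inv ≫ f.appLE ⊤ U le_top = ψ := by
  have h' := congrArg (fun q => q.appTop) h
  simp only [Scheme.Hom.comp_appTop, Scheme.Opens.toSpecΓ_appTop] at h'
  have h2 : f.appTop ≫ U.ι.appTop = f.appLE ⊤ U le_top ≫ U.topIso.inv := by
    refine Eq.trans ?_ (Category.assoc _ _ _).symm
    exact congrArg (f.appTop ≫ ·) (X.presheaf.map_comp _ _)
  rw [h2, Scheme.ΓSpecIso_naturality_assoc, ← Category.assoc (Scheme.ΓSpecIso R).hom] at h'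
  replace h' := (cancel_mono _).1 h'
  rw [h', Iso.inv_hom_id_assoc]

lemma Proj.basicOpen_ι_toSpecZero {σ : Type*} {A : Type u} [CommRing A] [SetLike σ A]
    [AddSubgroupClass σ A] (𝒜 : ℕ → σ) [GradedRing 𝒜] {f : A} {m : ℕ} (hf : f ∈ 𝒜 m)
    (hm : 0 < m) : (Proj.basicOpen 𝒜 f).ι ≫ Proj.toSpecZero 𝒜 = (Proj.basicOpen 𝒜 f).toSpecΓ ≫
      Spec.map (CommRingCat.ofHom (HomogeneousLocalization.fromZeroRingHom 𝒜 _) ≫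
        Proj.awayToSection 𝒜 f) := by
  have := Proj.awayι_toSpecZero 𝒜 f hf hm
  rw [← Proj.basicOpenIsoSpec_inv_ι, Category.assoc, Iso.inv_comp_eq] at this
  rw [this, Proj.basicOpenIsoSpec_hom, Proj.basicOpenToSpec, Category.assoc, ← Spec.map_comp]

section
open HomogeneousLocalization
variable {k : Type u} [Field k] {N : ℕ}

/-- The chart `(k[X₀, …, X_N]_{X_j})₀` of projective space. -/
abbrev ProjChart (k : Type u) [Field k] (N : ℕ) (j : Fin (N + 1)) : Type u :=
  Away (MvPolynomial.homogeneousSubmodule (Fin (N + 1)) k) (MvPolynomial.X j)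

/-- The open subset `X_j ≠ 0` of projective space. -/
def ProjSpace.chart (k : Type u) [Field k] (N : ℕ) (j : Fin (N + 1)) : (ProjSpace k N).Opens :=
  Proj.basicOpen (MvPolynomial.homogeneousSubmodule (Fin (N + 1)) k) (MvPolynomial.X j)

lemma ProjSpace.isAffineOpen_chart (j : Fin (N + 1)) : IsAffineOpen (ProjSpace.chart k N j) :=
  Proj.isAffineOpen_basicOpen _ _ (MvPolynomial.isHomogeneous_X k j) one_pos

def ProjSpace.chartSection (k : Type u) [Field k] (N : ℕ) (j : Fin (N + 1)) :
    ProjChart k N j →+* Γ(ProjSpace k N, ProjSpace.chart k N j) :=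
  (Proj.awayToSection (MvPolynomial.homogeneousSubmodule (Fin (N + 1)) k)
    (MvPolynomial.X j)).hom

lemma ProjSpace.chartSection_surjective (j : Fin (N + 1)) :
    Function.Surjective (ProjSpace.chartSection k N j) :=
  (Proj.basicOpenIsoAway (MvPolynomial.homogeneousSubmodule (Fin (N + 1)) k) (MvPolynomial.X j)
    (MvPolynomial.isHomogeneous_X k j) one_pos).commRingCatIsoToRingEquiv.surjective

lemma ProjSpace.chartSection_C (j : Fin (N + 1)) (c : k) :
    toSections (ProjSpace.str k N) (ProjSpace.chart k N j) c =
      ProjSpace.chartSection k N j (fromZeroRingHom _ _ (degreeZeroInclusion k N c)) := by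
  let ψ : CommRingCat.of k ⟶ Γ(ProjSpace k N, ProjSpace.chart k N j) :=
    CommRingCat.ofHom (degreeZeroInclusion k N) ≫ CommRingCat.ofHom (fromZeroRingHom _ _) ≫
      Proj.awayToSection (MvPolynomial.homogeneousSubmodule (Fin (N + 1)) k) (MvPolynomial.X j)
  have h : (ProjSpace.chart k N j).ι ≫ ProjSpace.str k N =
      (ProjSpace.chart k N j).toSpecΓ ≫ Spec.map ψ := by
    have := Proj.basicOpen_ι_toSpecZero (MvPolynomial.homogeneousSubmodule (Fin (N + 1)) k)
      (MvPolynomial.isHomogeneous_X k j) one_pos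
    refine (Category.assoc _ _ _).symm.trans ?_
    refine (congrArg (· ≫ Spec.map (CommRingCat.ofHom (degreeZeroInclusion k N))) this).trans ?_
    refine (Category.assoc _ _ _).trans ?_
    rw [← Spec.map_comp]
    rfl
  exact congrArg (fun q => q.hom c) (ΓSpecIso_inv_appLE_of_ι_comp (R := CommRingCat.of k) _ _ _ h)

lemma ProjSpace.iSup_chart : ⨆ j, ProjSpace.chart k N j = ⊤ :=
  Proj.iSup_basicOpen_eq_top' _ _ (fun i => ⟨1, MvPolynomial.isHomogeneous_X k i⟩) (by
    refine eq_top_iff.2 fun p _ => ?_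
    induction p using MvPolynomial.induction_on with
    | C c => exact Subalgebra.algebraMap_mem _ (degreeZeroInclusion k N c)
    | add p q hp hq => exact add_mem (hp trivial) (hq trivial)
    | mul_X p i hp => exact mul_mem (hp trivial) (Algebra.subset_adjoin ⟨i, rfl⟩))

end

section
open HomogeneousLocalization
variable {k : Type u} [Field k] {N : ℕ}

/-- The coordinate function `X_i / X_j`. -/
def ProjSpace.coord (k : Type u) [Field k] (N : ℕ) (i j : Fin (N + 1)) : ProjChart k N j :=
  Away.mk (MvPolynomial.homogeneousSubmodule (Fin (N + 1)) k)
    (MvPolynomial.isHomogeneous_X k j) 1 (MvPolynomial.X i)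
    (by simpa using MvPolynomial.isHomogeneous_X k i)

lemma ProjSpace.exists_coordinates (p : ProjSpace k N) (j₀ : Fin (N + 1))
    (h₀ : p ∈ ProjSpace.chart k N j₀) :
    ∃ z : Fin (N + 1) → (ProjSpace k N).presheaf.stalk p, z j₀ = 1 ∧
      (∀ j, IsUnit (z j) ↔ p ∈ ProjSpace.chart k N j) ∧
      ∀ j (hj : p ∈ ProjSpace.chart k N j) i, z j * (ProjSpace k N).presheaf.germ _ p hj
        (ProjSpace.chartSection k N j (ProjSpace.coord k N i j)) = z i := by
  let 𝒜 := MvPolynomial.homogeneousSubmodule (Fin (N + 1)) k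
  haveI : (ProjectiveSpectrum.asHomogeneousIdeal p).toIdeal.IsPrime :=
    ProjectiveSpectrum.isPrime p
  let σ : AtPrime 𝒜 (ProjectiveSpectrum.asHomogeneousIdeal p).toIdeal ≃+*
    (ProjSpace k N).presheaf.stalk p := (Proj.stalkIso' 𝒜 p).symm
  have hσ : ∀ j (hj : p ∈ ProjSpace.chart k N j) (a : ProjChart k N j),
      (ProjSpace k N).presheaf.germ _ p hj (ProjSpace.chartSection k N j a) =
        σ (mapId 𝒜 (Submonoid.powers_le.mpr hj) a) := fun j hj a =>
    congrArg (fun q => q.hom a) (ProjectiveSpectrum.Proj.awayToSection_germ 𝒜 _ p hj)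
  let y : Fin (N + 1) → AtPrime 𝒜 (ProjectiveSpectrum.asHomogeneousIdeal p).toIdeal := fun i =>
    mapId 𝒜 (Submonoid.powers_le.mpr h₀) (ProjSpace.coord k N i j₀)
  have hy : ∀ i j hj, (mapId 𝒜 (Submonoid.powers_le.mpr hj) (ProjSpace.coord k N i j) :
      AtPrime 𝒜 (ProjectiveSpectrum.asHomogeneousIdeal p).toIdeal).val =
      Localization.mk (MvPolynomial.X i) ⟨MvPolynomial.X j, hj⟩ := by
    intro i j hj
    refine Eq.trans (b := Localization.mk (MvPolynomial.X i)
      ⟨MvPolynomial.X j ^ 1, by rwa [pow_one]⟩) rfl ?_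
    congr 1
    exact Subtype.ext (pow_one _)
  refine ⟨fun i => σ (y i), ?_, fun j => ?_, fun j hj i => ?_⟩
  · have : y j₀ = 1 := by
      apply val_injective
      rw [hy _ _ h₀, val_one, ← Localization.mk_self ⟨MvPolynomial.X j₀, h₀⟩]
    simp only [this, map_one]
  · rw [MulEquiv.isUnit_map, ← HomogeneousLocalization.isUnit_iff_isUnit_val]
    erw [hy _ _ h₀]
    rw [Localization.mk_eq_mk', IsLocalization.AtPrime.isUnit_mk'_iff]
    exact Iff.rfl
  · dsimp only
    rw [hσ, ← map_mul]
    congr 1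
    apply val_injective
    rw [val_mul]
    erw [hy _ _ h₀, hy _ _ h₀, hy _ _ hj]
    rw [Localization.mk_mul, Localization.mk_eq_mk_iff, Localization.r_iff_exists]
    exact ⟨1, by simp; ring⟩
end

section
open HomogeneousLocalization
variable {k : Type u} [Field k]  {X : Scheme.{u}} [IsIntegral X] {sX : X ⟶ Spec (CommRingCat.of k)}

lemma app_toSections_of_comp {X Y : Scheme.{u}} {sX : X ⟶ Spec (CommRingCat.of k)}
    {sY : Y ⟶ Spec (CommRingCat.of k)} {f : X ⟶ Y} (hf : f ≫ sY = sX) (U : Y.Opens) (c : k) :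
    f.app U (toSections sY U c) = toSections sX (f ⁻¹ᵁ U) c := by
  subst hf
  rw [toSections_eq_appLE, toSections_eq_appLE]
  simp only [RingHom.comp_apply]
  have : (f ≫ sY).appLE ⊤ (f ⁻¹ᵁ U) le_top = sY.appLE ⊤ U le_top ≫ f.app U := by
    rw [Scheme.Hom.app_eq_appLE]
    exact (Scheme.Hom.appLE_comp_appLE f sY ⊤ U (f ⁻¹ᵁ U) le_top le_rfl).symm
  rw [this]
  rfl

lemma IsProjectiveVariety.exists_coordinates (hX : IsProjectiveVariety sX) :
    ∃ (N : ℕ) (U : Fin (N + 1) → X.Opens) (z : Fin (N + 1) → FF sX) (j₀ : Fin (N + 1)),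
      z j₀ = 1 ∧ (∀ j, IsAffineOpen (U j)) ∧ ∀ j, z j ≠ 0 → ∃ h : genericPoint X ∈ U j,
        ∀ s, gm sX (U j) h s ∈ Algebra.adjoin k (Set.range fun i => z i / z j) := by
  obtain ⟨-, N, ι, hι, hs⟩ := hX
  have hmem : ι (genericPoint X) ∈ ⨆ j, ProjSpace.chart k N j := by
    rw [ProjSpace.iSup_chart]; trivial
  obtain ⟨j₀, hj₀⟩ := TopologicalSpace.Opens.mem_iSup.1 hmem
  obtain ⟨y, hy₀, hyu, hy⟩ := ProjSpace.exists_coordinates _ j₀ hj₀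
  let τ : (ProjSpace k N).presheaf.stalk (ι (genericPoint X)) →+* FF sX :=
    (ι.stalkMap (genericPoint X)).hom
  have hτ : IsLocalHom τ := inferInstanceAs (IsLocalHom (ι.stalkMap (genericPoint X)).hom)
  have hgm : ∀ (V : (ProjSpace k N).Opens) (h : genericPoint X ∈ ι ⁻¹ᵁ V) (s),
      gm sX (ι ⁻¹ᵁ V) h (ι.app V s) = τ ((ProjSpace k N).presheaf.germ V _ h s) := fun V h s =>
    (ι.germ_stalkMap_apply V (genericPoint X) h s).symm
  refine ⟨N, fun j => ι ⁻¹ᵁ ProjSpace.chart k N j, fun j => τ (y j), j₀, by simp only [hy₀, map_one],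
    fun j => (ProjSpace.isAffineOpen_chart j).preimage ι, fun j hj => ?_⟩
  have hjc : ι (genericPoint X) ∈ ProjSpace.chart k N j :=
    (hyu j).1 (hτ.map_nonunit _ (isUnit_iff_ne_zero.2 hj))
  have hjc' : genericPoint X ∈ ι ⁻¹ᵁ ProjSpace.chart k N j := hjc
  refine ⟨hjc', fun s => ?_⟩
  obtain ⟨s, rfl⟩ := ι.app_surjective _ (ProjSpace.isAffineOpen_chart j) s
  obtain ⟨a, rfl⟩ := ProjSpace.chartSection_surjective j s
  have ha : a ∈ Algebra.adjoin (MvPolynomial.homogeneousSubmodule (Fin (N + 1)) k 0)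
      (Set.range fun i => ProjSpace.coord k N i j) := by
    have := adjoin_away_X_eq_top (k := k) j
    exact this.ge trivial
  change gm sX (ι ⁻¹ᵁ ProjSpace.chart k N j) hjc' (ι.app _ (ProjSpace.chartSection k N j a)) ∈
    Algebra.adjoin k (Set.range fun i => τ (y i) / τ (y j))
  replace hj : τ (y j) ≠ 0 := hj
  induction ha using Algebra.adjoin_induction with
  | mem x hx =>
    obtain ⟨i, rfl⟩ := hx
    refine Algebra.subset_adjoin ⟨i, Eq.trans ?_ (hgm _ hjc' _).symm⟩
    simp only
    rw [div_eq_iff hj, ← hy j hjc i, map_mul, mul_comm]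
  | algebraMap r =>
    obtain ⟨c, rfl⟩ := degreeZeroInclusion_surjective k N r
    have h1 := ProjSpace.chartSection_C j c
    have h2 : gm sX (ι ⁻¹ᵁ ProjSpace.chart k N j) hjc' (ι.app _ (toSections (ProjSpace.str k N) _ c))
        ∈ Algebra.adjoin k (Set.range fun i => τ (y i) / τ (y j)) := by
      rw [app_toSections_of_comp hs, gm_toSections]
      exact Subalgebra.algebraMap_mem _ _
    rw [h1] at h2
    exact h2
  | add a b _ _ ha hb =>
    rw [map_add, map_add, map_add]
    exact add_mem ha hb
  | mul a b _ _ ha hb =>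
    rw [map_mul, map_mul, map_mul]
    exact mul_mem ha hb
end

end Filtration

section Finiteness

variable {k : Type u} [Field k]  {X : Scheme.{u}} [IsIntegral X] {sX : X ⟶ Spec (CommRingCat.of k)}

lemma finite_secW [CompactSpace X] (hX : IsProjectiveVariety sX) (δ : X → FF sX)
    (hδ : ∀ x, δ x ≠ 0)
    (hloc : ∀ x, ∃ U : Set X, IsOpen U ∧ x ∈ U ∧ ∀ x' ∈ U,
      δ x' / δ x ∈ locRing sX x' ∧ δ x / δ x' ∈ locRing sX x') (n : ℕ) :
    Module.Finite k (secW (locRing sX) δ n) := by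
  classical
  obtain ⟨N, U, z, j₀, hz, hU, hadj⟩ := hX.exists_coordinates
  choose W hWo hxW hW using hloc
  obtain ⟨t, ht⟩ := isCompact_univ.elim_finite_subcover W hWo
    (fun x _ => Set.mem_iUnion.2 ⟨x, hxW x⟩)
  refine finite_of_charts z j₀ hz _ fun j hj => ?_
  obtain ⟨h, hs⟩ := hadj j hj
  have hden : ∀ l : X, ∃ a s : Γ(X, U j), s ≠ 0 ∧ δ l ^ n * gm sX (U j) h s = gm sX (U j) h a := by
    intro l
    obtain ⟨a, s, hs0, -, hf⟩ := exists_div_of_mem_locRing sX (hU j) h h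
      (f := δ l ^ n) (by rw [locRing_genericPoint]; trivial)
    have : gm sX (U j) h s ≠ 0 := fun h0 => hs0 (gm_injective sX (U j) h (h0.trans (map_zero _).symm))
    exact ⟨a, s, hs0, by rw [hf, div_mul_cancel₀ _ this]⟩
  choose a s hs0 has using hden
  have hne : Nonempty (U j) := ⟨⟨_, h⟩⟩
  refine ⟨gm sX (U j) h (∏ l ∈ t, s l), ?_, hs _, fun v hv => ?_⟩
  · rw [map_prod]
    refine Finset.prod_ne_zero_iff.2 fun l _ h0 =>
      hs0 l (gm_injective sX (U j) h (h0.trans (map_zero _).symm))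
  · obtain ⟨b, hb⟩ := exists_gm_of_forall_mem_locRing sX h (f := gm sX (U j) h (∏ l ∈ t, s l) * v) (by
      intro x hx
      obtain ⟨l, hl, hxl⟩ := Set.mem_iUnion₂.1 (ht (Set.mem_univ x))
      obtain ⟨r, hr⟩ := Finset.dvd_prod_of_mem s hl
      rw [hr, map_mul]
      have e : gm sX (U j) h (s l) * gm sX (U j) h r * v =
          gm sX (U j) h (a l * r) * (v / δ x ^ n * (δ x / δ l) ^ n) := by
        rw [map_mul, ← has l, div_pow]
        have h1 := hδ x
        have h2 := hδ l
        field_simp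
      rw [e]
      exact mul_mem (gm_mem_locRing sX hx h _) (mul_mem (hv x) (pow_mem (hW l x hxl).1 n)))
    rw [← hb]
    exact hs b

end Finiteness

section SmoothCharts

variable {k : Type u} [Field k] {X : Scheme.{u}} (sX : X ⟶ Spec (CommRingCat.of k))

lemma exists_smooth_chart [Smooth sX] {W : X.Opens} {x : X} (hx : x ∈ W) :
    ∃ U : X.Opens, IsAffineOpen U ∧ x ∈ U ∧ U ≤ W ∧
      (LineBundle.toSections sX U).IsStandardSmooth := by
  obtain ⟨T, hT, V, hV, hxV, e, hs⟩ := Smooth.exists_isStandardSmooth sX x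
  have hT' : T = ⊤ := by
    refine top_unique fun y _ => ?_
    have : y = sX x := Subsingleton.elim (α := PrimeSpectrum k) _ _
    rw [this]
    exact e hxV
  subst hT'
  obtain ⟨b, hb, hxb⟩ := hV.exists_basicOpen_le ⟨x, hx⟩ hxV
  refine ⟨X.basicOpen b, hV.basicOpen b, hxb, hb, ?_⟩
  have h1 : (LineBundle.toSections sX V).IsStandardSmooth := by
    rw [toSections_eq_appLE]
    exact RingHom.isStandardSmooth_respectsIso.2 _
      (Scheme.ΓSpecIso (CommRingCat.of k)).symm.commRingCatIsoToRingEquiv hs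
  have h2 : (sres X (X.basicOpen_le b)).IsStandardSmooth := by
    have := hV.isLocalization_basicOpen b
    exact RingHom.isStandardSmooth_holdsForLocalizationAway _ b
  have h3 := h2.comp h1
  rwa [show (sres X (X.basicOpen_le b)).comp (LineBundle.toSections sX V) =
    LineBundle.toSections sX (X.basicOpen b) from
      RingHom.ext fun c => LineBundle.sres_toSections sX _ c] at h3

variable [IsIntegral X]

lemma mem_range_gm_of_isIntegralElem [Smooth sX] {U : X.Opens} (hU : genericPoint X ∈ U)
    {y : FF sX} (hy : (gm sX U hU).IsIntegralElem y) : y ∈ Set.range (gm sX U hU) := by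
  refine exists_gm_of_forall_mem_locRing sX hU fun x hx => ?_
  obtain ⟨V, hV, hxV, hVU, hs⟩ := exists_smooth_chart sX hx
  have hη : genericPoint X ∈ V := genericPoint_mem hxV
  letI : Algebra k Γ(X, V) := (LineBundle.toSections sX V).toAlgebra
  letI : Algebra Γ(X, V) (FF sX) := (gm sX V hη).toAlgebra
  haveI : Nonempty V := ⟨⟨_, hη⟩⟩
  haveI : IsFractionRing Γ(X, V) (FF sX) := functionField_isFractionRing_of_isAffineOpen X V hV
  haveI : Algebra.IsStandardSmooth k Γ(X, V) := hs
  haveI : IsIntegrallyClosed Γ(X, V) := isIntegrallyClosed_of_isStandardSmooth (k := k)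
  have h1 : IsIntegral Γ(X, V) y := by
    obtain ⟨p, hp, hp0⟩ := hy
    refine ⟨p.map (sres X hVU), hp.map _, ?_⟩
    rw [Polynomial.eval₂_map]
    convert hp0 using 2
    exact RingHom.ext fun s => gm_sres sX hVU hη s
  obtain ⟨s, rfl⟩ := IsIntegrallyClosed.isIntegral_iff.1 h1
  exact gm_mem_locRing sX hxV hη s

lemma isFractionRing_sections_of_basis [PerfectField k] [Smooth sX] {g : ℕ}
    (hdim : topologicalKrullDim X = (g : ℕ∞)) {U : X.Opens} (hU : genericPoint X ∈ U)
    [Algebra k Γ(X, U)] [Algebra Γ(X, U) (FF sX)] [IsScalarTower k Γ(X, U) (FF sX)]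
    (hK : algebraMap Γ(X, U) (FF sX) = gm sX U hU) (b : Module.Basis (Fin g) Γ(X, U) Ω[Γ(X, U)⁄k]) :
    IsFractionRing Γ(X, U) (FF sX) := by
  haveI : Nonempty U := ⟨⟨_, hU⟩⟩
  refine isFractionRing_of_basis_differentials (hK ▸ gm_injective sX U hU) b
    (trdeg_functionField_le sX hdim) fun y hy => ?_
  have := mem_range_gm_of_isIntegralElem sX hU (y := y) (by rw [← hK]; exact hy)
  rwa [← hK] at this

end SmoothCharts

section DifferentialCharts

lemma kaehlerDifferential_map_map {k A C K : Type*} [CommRing k] [CommRing A] [CommRing C]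
    [CommRing K] [Algebra k A] [Algebra k C] [Algebra k K] [Algebra A C] [Algebra A K] [Algebra C K]
    [IsScalarTower k A C] [IsScalarTower k A K] [IsScalarTower k C K] [IsScalarTower A C K]
    [SMulCommClass k A C] [SMulCommClass k A K] [SMulCommClass k C K] (w : Ω[A⁄k]) :
    KaehlerDifferential.map k k C K (KaehlerDifferential.map k k A C w) =
      KaehlerDifferential.map k k A K w := by
  have hw : w ∈ Submodule.span A (Set.range (KaehlerDifferential.D k A)) := by
    rw [KaehlerDifferential.span_range_derivation]; trivial
  induction hw using Submodule.span_induction with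
  | zero => simp
  | add a b _ _ ha hb => simp only [map_add, ha, hb]
  | smul c a _ ha =>
    have h1 := (KaehlerDifferential.map k k A C).map_smul c a
    have h2 := (KaehlerDifferential.map k k A K).map_smul c a
    rw [h1, h2, ← algebraMap_smul C c (KaehlerDifferential.map k k A C a),
      (KaehlerDifferential.map k k C K).map_smul, ha, algebraMap_smul]
  | mem a ha =>
    obtain ⟨i, rfl⟩ := ha
    simp only [KaehlerDifferential.map_D, ← IsScalarTower.algebraMap_apply]

lemma det_change_of_differentials {k K A B C : Type*} [Field k] [Field K] [Algebra k K]
    [CommRing A] [CommRing B] [CommRing C] [Algebra k A] [Algebra k B] [Algebra k C]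
    [Algebra A C] [Algebra B C] [IsScalarTower k A C] [IsScalarTower k B C]
    [SMulCommClass k A C] [SMulCommClass k B C]
    [Algebra A K] [Algebra B K] [Algebra C K] [IsScalarTower k A K] [IsScalarTower k B K]
    [IsScalarTower k C K] [IsScalarTower A C K] [IsScalarTower B C K]
    {g : ℕ} (θ eA eB : Module.Basis (Fin g) K Ω[K⁄k]) (bA : Fin g → Ω[A⁄k]) (bB : Fin g → Ω[B⁄k])
    (heA : ∀ i, eA i = KaehlerDifferential.map k k A K (bA i))
    (heB : ∀ i, eB i = KaehlerDifferential.map k k B K (bB i))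
    (M : Matrix (Fin g) (Fin g) C)
    (hM : ∀ a, KaehlerDifferential.map k k B C (bB a) =
      ∑ b, M a b • KaehlerDifferential.map k k A C (bA b)) :
    θ.det eB = algebraMap C K M.det * θ.det eA := by
  have hc : ∀ (c : C) (v : Ω[C⁄k]), KaehlerDifferential.map k k C K (c • v) =
      algebraMap C K c • KaehlerDifferential.map k k C K v := by
    intro c v
    rw [map_smul]; exact algebra_compatible_smul K c _
  have h1 : ∀ a, eB a = ∑ b, algebraMap C K (M a b) • eA b := by
    intro a
    rw [heB, ← kaehlerDifferential_map_map (C := C), hM, map_sum]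
    exact Finset.sum_congr rfl fun b _ => by
      rw [hc, kaehlerDifferential_map_map, heA]
  have h2 : θ.toMatrix eB = θ.toMatrix eA * (M.map (algebraMap C K)).transpose := by
    ext i a
    rw [Module.Basis.toMatrix_apply, h1, Matrix.mul_apply, map_sum, Finsupp.finsetSum_apply]
    refine Finset.sum_congr rfl fun b _ => ?_
    rw [map_smul, Finsupp.smul_apply, smul_eq_mul, mul_comm]
    rfl
  rw [Module.Basis.det_apply, Module.Basis.det_apply, h2, Matrix.det_mul, Matrix.det_transpose,
    ← RingHom.mapMatrix_apply, ← RingHom.map_det, mul_comm]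

variable {k : Type u} [Field k] {X : Scheme.{u}} [IsIntegral X] (sX : X ⟶ Spec (CommRingCat.of k))

lemma exists_basis_of_basis_sections {g : ℕ} {U : X.Opens} (hU : genericPoint X ∈ U)
    [Algebra k Γ(X, U)] [Algebra Γ(X, U) (FF sX)] [IsScalarTower k Γ(X, U) (FF sX)]
    (hK : algebraMap Γ(X, U) (FF sX) = gm sX U hU) [IsFractionRing Γ(X, U) (FF sX)]
    (b : Module.Basis (Fin g) Γ(X, U) Ω[Γ(X, U)⁄k]) :
    ∃ e : Module.Basis (Fin g) (FF sX) Ω[FF sX⁄k],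
      (∀ i, e i = KaehlerDifferential.map k k Γ(X, U) (FF sX) (b i)) ∧
      (∀ x ∈ U, ∀ i, e i ∈ diffLattice (locRing sX x)) ∧
      (IsAffineOpen U → ∀ x ∈ U, IsDiffBasis (locRing sX x) e) := by
  haveI : Nonempty U := ⟨⟨_, hU⟩⟩
  obtain ⟨e, he, hd⟩ := exists_isDiffBasis_of_basis (K := FF sX) b
  have hle : ∀ x ∈ U, (IsScalarTower.toAlgHom k Γ(X, U) (FF sX)).range ≤ locRing sX x := by
    rintro x hx _ ⟨s, rfl⟩
    have := gm_mem_locRing sX hx hU s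
    rwa [← hK] at this
  refine ⟨e, he, fun x hx i => diffLattice_mono (hle x hx) (hd.mem i), fun hUa x hx =>
    hd.of_localization (hle x hx) fun f hf => ?_⟩
  obtain ⟨a, s, -, hs, rfl⟩ := exists_div_of_mem_locRing sX hUa hx hU hf
  rw [← hK] at hs ⊢
  exact ⟨_, ⟨a, rfl⟩, _, ⟨s, rfl⟩, hs, rfl⟩

lemma exists_basis_of_chart {g : ℕ} (θ : Module.Basis (Fin g) (FF sX) Ω[FF sX⁄k])
    {U : X.Opens} (hU : genericPoint X ∈ U) (hUa : IsAffineOpen U)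
    (hs : (LineBundle.toSections sX U).IsStandardSmooth)
    [Algebra k Γ(X, U)] (hk : algebraMap k Γ(X, U) = LineBundle.toSections sX U)
    [hA : Algebra Γ(X, U) (FF sX)] [IsScalarTower k Γ(X, U) (FF sX)]
    (hK : algebraMap Γ(X, U) (FF sX) = gm sX U hU) :
    ∃ (b : Module.Basis (Fin g) Γ(X, U) Ω[Γ(X, U)⁄k])
      (e : Module.Basis (Fin g) (FF sX) Ω[FF sX⁄k]),
      (∀ i, e i = KaehlerDifferential.map k k Γ(X, U) (FF sX) (b i)) ∧
      ∀ x ∈ U, IsDiffBasis (locRing sX x) e := by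
  haveI : Nonempty U := ⟨⟨_, hU⟩⟩
  haveI : IsFractionRing Γ(X, U) (FF sX) := by
    obtain rfl : hA = (gm sX U hU).toAlgebra := Algebra.algebra_ext _ _ (DFunLike.congr_fun hK)
    exact functionField_isFractionRing_of_isAffineOpen X U hUa
  haveI : Algebra.IsStandardSmooth k Γ(X, U) := by
    rw [← RingHom.isStandardSmooth_algebraMap, hk]
    exact hs
  let b₀ := (Module.Free.chooseBasis Γ(X, U) Ω[Γ(X, U)⁄k])
  let b₁ := b₀.reindex (Fintype.equivFin _)
  obtain ⟨e₁, -⟩ := exists_basis_of_basis_sections sX hU hK b₁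
  have hg : Fintype.card (Module.Free.ChooseBasisIndex Γ(X, U) Ω[Γ(X, U)⁄k]) = g := by
    rw [← Fintype.card_fin g, ← Module.finrank_eq_card_basis θ, Module.finrank_eq_card_basis e₁,
      Fintype.card_fin]
  obtain ⟨e, he, -, h⟩ := exists_basis_of_basis_sections sX hU hK (b₁.reindex (finCongr hg))
  exact ⟨_, e, he, h hUa⟩

end DifferentialCharts

section CanonicalSection

variable {k : Type u} [Field k] {X : Scheme.{u}} [IsIntegral X] {sX : X ⟶ Spec (CommRingCat.of k)}

lemma IsCanonicalBundle.exists_frames [PerfectField k] [Smooth sX] {g : ℕ}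
    (hdim : topologicalKrullDim X = (g : ℕ∞)) {ω : LineBundle X} (hω : IsCanonicalBundle sX g ω) :
    ∃ e : ∀ i, genericPoint X ∈ ω.U i → Module.Basis (Fin g) (FF sX) Ω[FF sX⁄k],
      (∀ i hi, ∀ x ∈ ω.U i, ∀ a, e i hi a ∈ diffLattice (locRing sX x)) ∧
      ∀ i j hi hj, ∀ θ : Module.Basis (Fin g) (FF sX) Ω[FF sX⁄k], θ.det (e j hj) =
        gm sX (ω.U i ⊓ ω.U j) ⟨hi, hj⟩ (ω.t i j) * θ.det (e i hi) := by
  letI : ∀ U : X.Opens, Algebra k Γ(X, U) := fun U => (LineBundle.toSections sX U).toAlgebra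
  obtain ⟨b, hb⟩ := hω
  have key : ∀ i (hi : genericPoint X ∈ ω.U i),
      letI : Algebra Γ(X, ω.U i) (FF sX) := (gm sX _ hi).toAlgebra
      haveI : IsScalarTower k Γ(X, ω.U i) (FF sX) :=
        IsScalarTower.of_algebraMap_eq fun c => (gm_toSections sX _ hi c).symm
      ∃ e : Module.Basis (Fin g) (FF sX) Ω[FF sX⁄k],
      (∀ a, e a = KaehlerDifferential.map k k Γ(X, ω.U i) (FF sX) (b i a)) ∧
      (∀ x ∈ ω.U i, ∀ a, e a ∈ diffLattice (locRing sX x)) := by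
    intro i hi
    letI : Algebra Γ(X, ω.U i) (FF sX) := (gm sX _ hi).toAlgebra
    haveI : IsScalarTower k Γ(X, ω.U i) (FF sX) :=
      IsScalarTower.of_algebraMap_eq fun c => (gm_toSections sX _ hi c).symm
    haveI := isFractionRing_sections_of_basis sX hdim hi rfl (b i)
    obtain ⟨e, h1, h2, -⟩ := exists_basis_of_basis_sections sX hi rfl (b i)
    exact ⟨e, h1, h2⟩
  choose e he hem using key
  refine ⟨e, hem, fun i j hi hj θ => ?_⟩
  letI : Algebra Γ(X, ω.U i) (FF sX) := (gm sX _ hi).toAlgebra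
  letI : Algebra Γ(X, ω.U j) (FF sX) := (gm sX _ hj).toAlgebra
  letI : Algebra Γ(X, ω.U i ⊓ ω.U j) (FF sX) := (gm sX (ω.U i ⊓ ω.U j) ⟨hi, hj⟩).toAlgebra
  letI : Algebra Γ(X, ω.U i) Γ(X, ω.U i ⊓ ω.U j) :=
    (sres X (inf_le_left : ω.U i ⊓ ω.U j ≤ ω.U i)).toAlgebra
  letI : Algebra Γ(X, ω.U j) Γ(X, ω.U i ⊓ ω.U j) :=
    (sres X (inf_le_right : ω.U i ⊓ ω.U j ≤ ω.U j)).toAlgebra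
  haveI : IsScalarTower k Γ(X, ω.U i) Γ(X, ω.U i ⊓ ω.U j) :=
    IsScalarTower.of_algebraMap_eq fun c => (LineBundle.sres_toSections sX _ c).symm
  haveI : IsScalarTower k Γ(X, ω.U j) Γ(X, ω.U i ⊓ ω.U j) :=
    IsScalarTower.of_algebraMap_eq fun c => (LineBundle.sres_toSections sX _ c).symm
  haveI : IsScalarTower k Γ(X, ω.U i) (FF sX) :=
    IsScalarTower.of_algebraMap_eq fun c => (gm_toSections sX _ hi c).symm
  haveI : IsScalarTower k Γ(X, ω.U j) (FF sX) :=
    IsScalarTower.of_algebraMap_eq fun c => (gm_toSections sX _ hj c).symm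
  haveI : IsScalarTower k Γ(X, ω.U i ⊓ ω.U j) (FF sX) :=
    IsScalarTower.of_algebraMap_eq fun c => (gm_toSections sX (ω.U i ⊓ ω.U j) ⟨hi, hj⟩ c).symm
  haveI : IsScalarTower Γ(X, ω.U i) Γ(X, ω.U i ⊓ ω.U j) (FF sX) :=
    IsScalarTower.of_algebraMap_eq fun c => (gm_sres sX inf_le_left _ c).symm
  haveI : IsScalarTower Γ(X, ω.U j) Γ(X, ω.U i ⊓ ω.U j) (FF sX) :=
    IsScalarTower.of_algebraMap_eq fun c => (gm_sres sX inf_le_right _ c).symm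
  obtain ⟨M, hM, ht⟩ := hb i j
  rw [ht]
  exact det_change_of_differentials θ (e i hi) (e j hj) (b i) (b j) (he i hi) (he j hj) M hM

lemma exists_mem_secW [PerfectField k] [Smooth sX] {g : ℕ}
    (hdim : topologicalKrullDim X = (g : ℕ∞)) {ω : LineBundle X} (hω : IsCanonicalBundle sX g ω) :
    ∃ θ : Module.Basis (Fin g) (FF sX) Ω[FF sX⁄k],
      ∀ (δ : X → FF sX), (∀ x, IsDet θ (locRing sX x) (δ x)) → ∀ n : ℕ,
        LineBundle.secSubmodule sX (ω.pow n) ≠ ⊥ → ∃ f ∈ secW (locRing sX) δ n, f ≠ 0 := by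
  obtain ⟨e, hem, het⟩ := hω.exists_frames hdim
  have hcov : ∀ x : X, ∃ i, x ∈ ω.U i := fun x => by
    have : x ∈ iSup ω.U := ω.covers ▸ trivial
    exact TopologicalSpace.Opens.mem_iSup.1 this
  obtain ⟨i₀, hi₀⟩ := hcov (genericPoint X)
  refine ⟨e i₀ hi₀, fun δ hδ n hn => ?_⟩
  set θ := e i₀ hi₀
  letI : ∀ i, Module k Γ(X, (ω.pow n).U i) := fun i => (LineBundle.toSections sX _).toModule
  obtain ⟨s, hs, hs0⟩ := (Submodule.ne_bot_iff _).1 hn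
  have hs' : ∀ i j (hi : genericPoint X ∈ ω.U i) (hj : genericPoint X ∈ ω.U j),
      gm sX (ω.U i) hi (s i) =
        gm sX (ω.U i ⊓ ω.U j) ⟨hi, hj⟩ (ω.t i j) ^ n * gm sX (ω.U j) hj (s j) := by
    intro i j hi hj
    have h1 := congrArg (gm sX (ω.U i ⊓ ω.U j) ⟨hi, hj⟩) (hs i j)
    refine ((gm_sres sX inf_le_left _ _).symm.trans (h1.trans (map_mul _ _ _))).trans ?_
    congr 1
    · rw [← map_pow]
      exact congrArg _ (Units.val_pow_eq_pow_val _ _)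
    · exact gm_sres sX inf_le_right _ _
  obtain ⟨i₁, hi₁⟩ : ∃ i, s i ≠ 0 := by
    by_contra! h
    exact hs0 (funext h)
  have hη₁ : genericPoint X ∈ ω.U i₁ := by
    by_contra h
    have hbot : ω.U i₁ = ⊥ := by
      ext x
      exact ⟨fun hx => h (genericPoint_mem hx), fun hx => hx.elim⟩
    have : Subsingleton Γ(X, ω.U i₁) := by
      rw [hbot]; infer_instance
    exact hi₁ (this.elim _ _)
  refine ⟨gm sX _ hη₁ (s i₁) * θ.det (e i₁ hη₁) ^ n, fun x => ?_, ?_⟩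
  · obtain ⟨j, hj⟩ := hcov x
    have hηj : genericPoint X ∈ ω.U j := genericPoint_mem hj
    have h1 : gm sX _ hη₁ (s i₁) * θ.det (e i₁ hη₁) ^ n =
        gm sX _ hηj (s j) * θ.det (e j hηj) ^ n := by
      rw [hs' i₁ j hη₁ hηj, het i₁ j hη₁ hηj θ, mul_pow]
      ring
    rw [h1, mul_div_assoc, ← div_pow]
    exact mul_mem (gm_mem_locRing sX hj _ _) (pow_mem ((hδ x).det_div_mem (hem j hηj x hj)) n)
  · refine mul_ne_zero ?_ (pow_ne_zero _ (θ.isUnit_det _).ne_zero)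
    exact fun h => hi₁ (gm_injective sX _ hη₁ (h.trans (map_zero _).symm))

end CanonicalSection

section EtaleConclusion

variable {k : Type u} [Field k] {X : Scheme.{u}} [IsIntegral X] {sX : X ⟶ Spec (CommRingCat.of k)}

lemma exists_isDet_charts [Smooth sX] {g : ℕ} (θ : Module.Basis (Fin g) (FF sX) Ω[FF sX⁄k]) :
    ∃ δ : X → FF sX, (∀ x, IsDet θ (locRing sX x) (δ x)) ∧
      ∀ x, ∃ U : Set X, IsOpen U ∧ x ∈ U ∧ ∀ x' ∈ U,
        δ x' / δ x ∈ locRing sX x' ∧ δ x / δ x' ∈ locRing sX x' := by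
  have h : ∀ x : X, ∃ (U : X.Opens) (d : FF sX), x ∈ U ∧ ∀ x' ∈ U, IsDet θ (locRing sX x') d := by
    intro x
    obtain ⟨U, hU, hxU, -, hs⟩ := exists_smooth_chart sX (W := ⊤) (x := x) trivial
    have hη : genericPoint X ∈ U := genericPoint_mem hxU
    letI : Algebra k Γ(X, U) := (LineBundle.toSections sX U).toAlgebra
    letI : Algebra Γ(X, U) (FF sX) := (gm sX U hη).toAlgebra
    haveI : IsScalarTower k Γ(X, U) (FF sX) :=
      IsScalarTower.of_algebraMap_eq fun c => (gm_toSections sX U hη c).symm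
    obtain ⟨b, e, -, he⟩ := exists_basis_of_chart sX θ hη hU hs rfl rfl
    exact ⟨U, θ.det e, hxU, fun x' hx' => ⟨e, he x' hx', rfl⟩⟩
  choose U d hxU hd using h
  exact ⟨d, fun x => hd x x (hxU x), fun x => ⟨U x, (U x).isOpen, hxU x, fun x' hx' =>
    ⟨(hd x x' hx').div_mem (hd x' x' (hxU x')), (hd x' x' (hxU x')).div_mem (hd x x' hx')⟩⟩⟩

lemma etale_of_jacobian_inv_mem [Smooth sX] {φ : X ⟶ X} (hφ : φ ≫ sX = sX) {E : FF sX →ₐ[k] FF sX}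
    (hE : ∀ (U : X.Opens) (hU : genericPoint X ∈ U) (hU' : genericPoint X ∈ φ ⁻¹ᵁ U) (s : Γ(X, U)),
      E (gm sX U hU s) = gm sX (φ ⁻¹ᵁ U) hU' (φ.app U s))
    {g : ℕ} (θ : Module.Basis (Fin g) (FF sX) Ω[FF sX⁄k])
    (P : Ω[FF sX⁄k] →+ Ω[FF sX⁄k]) (hP : ∀ c w, P (c • w) = E c • P w)
    (hPD : ∀ a, P (KaehlerDifferential.D k (FF sX) a) = KaehlerDifferential.D k (FF sX) (E a))
    {J : FF sX} (hJ : J ≠ 0)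
    (hPdet : ∀ v : Fin g → Ω[FF sX⁄k], θ.det (fun i => P (v i)) = E (θ.det v) * J)
    {δ : X → FF sX} (hδ : ∀ x, IsDet θ (locRing sX x) (δ x))
    (hinv : ∀ x, (E (δ (φ x)) * J / δ x)⁻¹ ∈ locRing sX x) : Etale φ := by
  rw [HasRingHomProperty.iff_exists_appLE (P := @Etale) (Q := RingHom.Etale)
    (RingHom.Etale.stableUnderComposition.stableUnderCompositionWithLocalizationAway
      fun R S _ _ _ r _ => RingHom.etale_algebraMap.2 (Algebra.Etale.of_isLocalizationAway r)).1]
  intro x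
  obtain ⟨V, hV, hxV, -, hsV⟩ := exists_smooth_chart sX (W := ⊤) (x := φ x) trivial
  obtain ⟨U, hU, hxU, hUV, hsU⟩ := exists_smooth_chart sX (W := φ ⁻¹ᵁ V) (x := x) hxV
  have hηV : genericPoint X ∈ V := genericPoint_mem hxV
  have hηU : genericPoint X ∈ U := genericPoint_mem hxU
  refine ⟨⟨V, hV⟩, ⟨U, hU⟩, hxU, hUV, ?_⟩
  letI : Algebra k Γ(X, U) := (LineBundle.toSections sX U).toAlgebra
  letI : Algebra k Γ(X, V) := (LineBundle.toSections sX V).toAlgebra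
  letI : Algebra Γ(X, U) (FF sX) := (gm sX U hηU).toAlgebra
  letI : Algebra Γ(X, V) (FF sX) := (gm sX V hηV).toAlgebra
  letI : Algebra Γ(X, V) Γ(X, U) := (φ.appLE V U hUV).hom.toAlgebra
  haveI : IsScalarTower k Γ(X, U) (FF sX) :=
    IsScalarTower.of_algebraMap_eq fun c => (gm_toSections sX U hηU c).symm
  haveI : IsScalarTower k Γ(X, V) (FF sX) :=
    IsScalarTower.of_algebraMap_eq fun c => (gm_toSections sX V hηV c).symm
  have happ : ∀ s, φ.appLE V U hUV s = sres X hUV (φ.app V s) := fun s => rfl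
  haveI : IsScalarTower k Γ(X, V) Γ(X, U) := IsScalarTower.of_algebraMap_eq fun c => by
    refine Eq.symm ((happ _).trans ?_)
    exact (congrArg (sres X hUV) (app_toSections_of_comp hφ V c)).trans
      (LineBundle.sres_toSections sX hUV c)
  haveI : Algebra.IsStandardSmooth k Γ(X, U) := hsU
  haveI : Algebra.IsStandardSmooth k Γ(X, V) := hsV
  obtain ⟨bA, eA, hA, hdA⟩ := exists_basis_of_chart sX θ hηV hV hsV rfl rfl
  obtain ⟨bB, eB, hB, hdB⟩ := exists_basis_of_chart sX θ hηU hU hsU rfl rfl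
  have hET : ∀ s : Γ(X, V), E (gm sX V hηV s) = gm sX U hηU (φ.appLE V U hUV s) := fun s =>
    (hE V hηV (hUV hηU) s).trans (gm_sres sX hUV hηU _).symm
  have hu : E (θ.det eA) * J ≠ 0 :=
    mul_ne_zero ((map_ne_zero E).2 (θ.isUnit_det eA).ne_zero) hJ
  haveI : Algebra.FormallyEtale Γ(X, V) Γ(X, U) := by
    refine formallyEtale_of_jacobian_inv_mem (k := k) (K := FF sX) (gm_injective sX U hηU) bA bB θ eA eB
      hA hB
      E hET P hP hPD hPdet hu ?_
    refine exists_gm_of_forall_mem_locRing sX hηU fun y hy => ?_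
    have hdet : IsDet θ (locRing sX (φ y)) (θ.det eA) := ⟨eA, hdA _ (hUV hy), rfl⟩
    have hdet' : IsDet θ (locRing sX y) (θ.det eB) := ⟨eB, hdB _ hy, rfl⟩
    have h1 := pullback_mem_locRing hE (hdet.div_mem (hδ (φ y)))
    have h2 := (hδ y).div_mem hdet'
    have h3 := mul_mem (mul_mem (hinv y) h1) h2
    convert h3 using 1
    have h4 := (hδ y).ne_zero
    have h5 : E (δ (φ y)) ≠ 0 := (map_ne_zero E).2 (hδ (φ y)).ne_zero
    have h6 := hdet'.ne_zero
    have h7 : E (θ.det eA) ≠ 0 := (map_ne_zero E).2 hdet.ne_zero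
    rw [map_div₀]
    field_simp
  haveI : Algebra.FinitePresentation Γ(X, V) Γ(X, U) :=
    .of_restrict_scalars_finitePresentation k _ _
  exact (⟨inferInstance, inferInstance⟩ : Algebra.Etale Γ(X, V) Γ(X, U))

end EtaleConclusion

/-- Let `X` be a smooth projective variety over an algebraically closed field,
`φ : X → X` a separable morphism and `L` an ample line bundle with `φ*(L) ≅ L^{⊗d}` for some
`d > 1`. If the Kodaira dimension of `X` is `≥ 0`, i.e. `H⁰(X, ω_X^{⊗n}) ≠ 0` for some
`n > 0` (`ω_X` the canonical bundle), then `φ` is étale. -/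
theorem stmt_9 {k : Type u} [Field k] [IsAlgClosed k] {X : Scheme.{u}} [IsIntegral X]
    (sX : X ⟶ Spec (CommRingCat.of k)) (hX : IsProjectiveVariety sX) (hsm : IsSmooth sX)
    (φ : X ⟶ X) (hφ : φ ≫ sX = sX) (hsep : IsSeparableSelfMap φ)
    (L : LineBundle X) (hL : L.IsAmple) (d : ℕ) (hd : 1 < d)
    (hpull : (LineBundle.pullbackLB φ L).EquivLB (L.pow d))
    (g : ℕ) (hdim : topologicalKrullDim X = (g : ℕ∞))
    (ω : LineBundle X) (hω : IsCanonicalBundle sX g ω)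
    (hkod : ∃ n : ℕ, 0 < n ∧ LineBundle.secSubmodule sX (ω.pow n) ≠ ⊥) :
    IsEtale φ := by
  haveI : Smooth sX := hsm
  haveI : CompactSpace X := hL.1
  haveI : IsLocallyNoetherian X := LocallyOfFiniteType.isLocallyNoetherian sX
  haveI : IsNoetherian X := {}
  haveI : TopologicalSpace.NoetherianSpace X := inferInstance
  obtain ⟨n, hn, hn'⟩ := hkod
  obtain ⟨θ, hθ⟩ := exists_mem_secW hdim hω
  obtain ⟨δ, hδ, hloc⟩ := exists_isDet_charts θ
  obtain ⟨f₀, hf₀, hf₀0⟩ := hθ δ hδ n hn'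
  obtain ⟨E, hE, hEsep⟩ := exists_pullback_functionField φ hφ hsep
  obtain ⟨P, hP, hPD, hJ, hPdet⟩ := exists_pull_differentials E hEsep θ θ
  obtain ⟨hη, -⟩ := hsep
  have hδ0 : ∀ x, δ x ≠ 0 := fun x => (hδ x).ne_zero
  haveI := finite_secW hX δ hδ0 hloc n
  refine etale_of_jacobian_inv_mem hφ hE θ P hP hPD hJ hPdet hδ ?_
  refine ramification_core (locRing sX) (isOpen_setOf_mem_locRing sX) δ hδ0 hloc n hn f₀ hf₀ hf₀0
    φ φ.continuous (hX.surjective hφ hη) E (fun x f hf => pullback_mem_locRing hE hf)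
    (fun x f hf hf' => inv_mem_locRing_of_pullback hE hf hf') _ hJ (fun x => ?_)
    (exists_codim_one_specialization sX)
  obtain ⟨e, he, hde⟩ := hδ (φ x)
  rw [← hde, ← hPdet]
  refine (hδ x).det_div_mem fun i => ?_
  have hv := he.mem i
  generalize e i = v at hv
  induction hv using Submodule.span_induction with
  | zero => rw [map_zero]; exact zero_mem _
  | add a b _ _ ha hb => rw [map_add]; exact add_mem ha hb
  | smul c a _ ha =>
    have h1 : P (c • a) = E (c : FF sX) • P a := hP c a
    rw [h1]
    exact (diffLattice (locRing sX x)).smul_mem ⟨E c, pullback_mem_locRing hE c.2⟩ ha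
  | mem a ha =>
    obtain ⟨c, rfl⟩ := ha
    change P (KaehlerDifferential.D k (FF sX) (c : FF sX)) ∈ _
    rw [hPD]
    exact D_mem_diffLattice _ (pullback_mem_locRing hE c.2)
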